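/- Let 0 = a_0 < a_1 < ⋯ < a_s = 1 be a subdivision of [0,1] and let m be a bounded C² function on (0,1) such that (∏_{0≤j≤s} |ξ − a_j|^k) |m^{(k)}(ξ)| ≤ c for all ξ ∈ (0,1) and k = 0, 1, 2, for some constant c > 0. Then the Fourier multiplier operator T_m is bounded from ℓ^p(ℤ) to ℓ^p(ℤ) for all 1 < p < ∞. -/

import Mathlib

open MeasureTheory Real Complex

/-- Discrete Fourier transform on `ℤ`: `F(f)(ξ) = ∑_{n ∈ ℤ} f(n) e^{2πi nξ}`. -/
noncomputable def dftZ (f : ℤ → ℂ) (ξ : ℝ) : ℂ :=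
  ∑' n : ℤ, f n * Complex.exp (2 * Real.pi * Complex.I * (n : ℂ) * (ξ : ℂ))

/-- The Fourier multiplier operator `T_m` on `ℤ`, given by `T_m f = F⁻¹(m · F(f))`. -/
noncomputable def TmultZ (m : ℝ → ℂ) (f : ℤ → ℂ) (n : ℤ) : ℂ :=
  ∫ ξ in Set.Ioo (0 : ℝ) 1, m ξ * dftZ f ξ *
    Complex.exp (-(2 * Real.pi * Complex.I) * (ξ : ℂ) * (n : ℂ))

/-- The `ℓ^p(ℤ)` norm, as the `L^p` norm with respect to counting measure. -/
noncomputable def lpNormZ (f : ℤ → ℂ) (p : ℝ) : ENNReal :=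
  eLpNorm f (ENNReal.ofReal p) (Measure.count : Measure ℤ)

/-- Calderón–Zygmund stopping-time decomposition on a dyadic-length interval of `ℤ`. -/
lemma exists_stopping_intervals (a : ℤ → ℝ) (ha : ∀ n, 0 ≤ a n) (lam : ℝ) (k : ℕ) :
    ∀ x : ℤ, ∑ j ∈ Finset.Ico x (x + 2 ^ k), a j ≤ lam * 2 ^ k →
    ∃ R : Finset (ℤ × ℕ),
      (∀ r ∈ R, Finset.Ico r.1 (r.1 + r.2) ⊆ Finset.Ico x (x + 2 ^ k)) ∧
      (∀ r ∈ R, 1 ≤ r.2) ∧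
      (R : Set (ℤ × ℕ)).PairwiseDisjoint (fun r => Finset.Ico r.1 (r.1 + r.2)) ∧
      (∀ r ∈ R, lam * r.2 < ∑ j ∈ Finset.Ico r.1 (r.1 + r.2), a j) ∧
      (∀ r ∈ R, ∑ j ∈ Finset.Ico r.1 (r.1 + r.2), a j ≤ 2 * lam * r.2) ∧
      (∀ n ∈ Finset.Ico x (x + 2 ^ k),
        (∀ r ∈ R, n ∉ Finset.Ico r.1 (r.1 + r.2)) → a n ≤ lam) := by
  classical
  induction k with
  | zero =>
    intro x hx
    refine ⟨∅, by simp, by simp, by simp, by simp, by simp, ?_⟩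
    intro n hn _
    have h1 : n = x := by
      simp only [pow_zero, Finset.mem_Ico] at hn; omega
    have h2 : Finset.Ico x (x + 2 ^ 0) = {x} := by
      ext; simp only [pow_zero, Finset.mem_Ico, Finset.mem_singleton]; omega
    rw [h2] at hx
    simpa [h1] using hx
  | succ k ih =>
    intro x hx
    have hp : (0 : ℤ) < 2 ^ k := by positivity
    have h2 : (2 : ℤ) ^ (k + 1) = 2 ^ k + 2 ^ k := by ring
    have split : Finset.Ico x (x + 2 ^ (k + 1)) =
        Finset.Ico x (x + 2 ^ k) ∪ Finset.Ico (x + 2 ^ k) (x + 2 ^ k + 2 ^ k) := by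
      ext n; simp only [Finset.mem_union, Finset.mem_Ico, h2]; omega
    have hdisj : Disjoint (Finset.Ico x (x + 2 ^ k))
        (Finset.Ico (x + 2 ^ k) (x + 2 ^ k + 2 ^ k)) := Finset.Ico_disjoint_Ico_consecutive _ _ _
    have half : ∀ y : ℤ, ∑ j ∈ Finset.Ico y (y + 2 ^ k), a j ≤ lam * 2 ^ (k + 1) →
      ∃ R : Finset (ℤ × ℕ),
      (∀ r ∈ R, Finset.Ico r.1 (r.1 + r.2) ⊆ Finset.Ico y (y + 2 ^ k)) ∧
      (∀ r ∈ R, 1 ≤ r.2) ∧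
      (R : Set (ℤ × ℕ)).PairwiseDisjoint (fun r => Finset.Ico r.1 (r.1 + r.2)) ∧
      (∀ r ∈ R, lam * r.2 < ∑ j ∈ Finset.Ico r.1 (r.1 + r.2), a j) ∧
      (∀ r ∈ R, ∑ j ∈ Finset.Ico r.1 (r.1 + r.2), a j ≤ 2 * lam * r.2) ∧
      (∀ n ∈ Finset.Ico y (y + 2 ^ k),
        (∀ r ∈ R, n ∉ Finset.Ico r.1 (r.1 + r.2)) → a n ≤ lam) := by
      intro y hy
      by_cases hle : ∑ j ∈ Finset.Ico y (y + 2 ^ k), a j ≤ lam * 2 ^ k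
      · exact ih y hle
      · refine ⟨{(y, 2 ^ k)}, ?_, ?_, ?_, ?_, ?_, ?_⟩
        · simp
        · simp [Nat.one_le_two_pow]
        · simp
        · simpa using hle
        · simp only [Finset.mem_singleton, forall_eq]
          push_cast
          refine hy.trans (le_of_eq ?_)
          ring
        · intro n hn h
          exact absurd hn (by simpa using h (y, 2 ^ k) (by simp))
    rw [split, Finset.sum_union hdisj] at hx
    have hn1 : 0 ≤ ∑ j ∈ Finset.Ico x (x + 2 ^ k), a j := Finset.sum_nonneg fun _ _ => ha _
    have hn2 : 0 ≤ ∑ j ∈ Finset.Ico (x + 2 ^ k) (x + 2 ^ k + 2 ^ k), a j :=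
      Finset.sum_nonneg fun _ _ => ha _
    obtain ⟨R, r1, r2, r3, r4, r5, r6⟩ := half x (by linarith)
    obtain ⟨S, s1, s2, s3, s4, s5, s6⟩ := half (x + 2 ^ k) (by linarith)
    refine ⟨R ∪ S, ?_, ?_, ?_, ?_, ?_, ?_⟩
    · intro r hr
      rw [split]
      rcases Finset.mem_union.1 hr with h | h
      · exact (r1 r h).trans Finset.subset_union_left
      · exact (s1 r h).trans Finset.subset_union_right
    · intro r hr
      rcases Finset.mem_union.1 hr with h | h
      exacts [r2 r h, s2 r h]
    · rw [Finset.coe_union, Set.pairwiseDisjoint_union]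
      exact ⟨r3, s3, fun r hr t ht _ =>
        Finset.disjoint_of_subset_left (r1 r hr) (Finset.disjoint_of_subset_right (s1 t ht) hdisj)⟩
    · intro r hr
      rcases Finset.mem_union.1 hr with h | h
      exacts [r4 r h, s4 r h]
    · intro r hr
      rcases Finset.mem_union.1 hr with h | h
      exacts [r5 r h, s5 r h]
    · intro n hn hnot
      rw [split] at hn
      rcases Finset.mem_union.1 hn with h | h
      · exact r6 n h fun r hr => hnot r (Finset.mem_union_left _ hr)
      · exact s6 n h fun r hr => hnot r (Finset.mem_union_right _ hr)

/-- Calderón–Zygmund decomposition of a nonnegative finitely supported function on `ℤ`. -/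
lemma exists_calderon_zygmund_intervals (a : ℤ → ℝ) (ha : ∀ n, 0 ≤ a n)
    (hfin : a.support.Finite) (lam : ℝ) (hlam : 0 < lam) :
    ∃ R : Finset (ℤ × ℕ),
      (∀ r ∈ R, 1 ≤ r.2) ∧
      (R : Set (ℤ × ℕ)).PairwiseDisjoint (fun r => Finset.Ico r.1 (r.1 + r.2)) ∧
      (∀ r ∈ R, lam * r.2 < ∑ j ∈ Finset.Ico r.1 (r.1 + r.2), a j) ∧
      (∀ r ∈ R, ∑ j ∈ Finset.Ico r.1 (r.1 + r.2), a j ≤ 2 * lam * r.2) ∧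
      (∀ n, (∀ r ∈ R, n ∉ Finset.Ico r.1 (r.1 + r.2)) → a n ≤ lam) := by
  classical
  obtain ⟨N, hN⟩ : ∃ N : ℕ, ∀ n ∈ a.support, |n| < N := by
    obtain ⟨b, hb⟩ := (hfin.image (fun n => n.natAbs)).bddAbove
    refine ⟨b + 1, fun n hn => ?_⟩
    have : n.natAbs ≤ b := hb ⟨n, hn, rfl⟩
    rw [Int.abs_eq_natAbs]
    omega
  obtain ⟨k1, hk1⟩ : ∃ k1 : ℕ, (∑ j ∈ hfin.toFinset, a j) / lam < 2 ^ k1 :=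
    pow_unbounded_of_one_lt _ (by norm_num)
  set k := max k1 N with hk
  have hNk : (N : ℤ) < 2 ^ k :=
    lt_of_lt_of_le (by exact_mod_cast Nat.lt_two_pow_self)
      (pow_le_pow_right₀ (by norm_num) (le_max_right k1 N))
  have hsum : ∑ j ∈ Finset.Ico (-2 ^ k : ℤ) (-2 ^ k + 2 ^ (k + 1)), a j ≤ lam * 2 ^ (k + 1) := by
    have h1 : ∑ j ∈ Finset.Ico (-2 ^ k : ℤ) (-2 ^ k + 2 ^ (k + 1)), a j
        ≤ ∑ j ∈ hfin.toFinset, a j := by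
      rw [← Finset.sum_filter_ne_zero]
      refine Finset.sum_le_sum_of_subset_of_nonneg (fun x hx => ?_) fun _ _ _ => ha _
      simpa using (Finset.mem_filter.1 hx).2
    have h2 : (2 : ℝ) ^ k1 ≤ 2 ^ (k + 1) :=
      pow_le_pow_right₀ (by norm_num) ((le_max_left k1 N).trans (Nat.le_succ _))
    rw [div_lt_iff₀ hlam] at hk1
    nlinarith
  obtain ⟨R, r1, r2, r3, r4, r5, r6⟩ := exists_stopping_intervals a ha lam (k + 1) _ hsum
  refine ⟨R, r2, r3, r4, r5, fun n hn => ?_⟩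
  by_cases h0 : a n = 0
  · rw [h0]; exact hlam.le
  · refine r6 n ?_ hn
    have := abs_lt.1 (hN n h0)
    rw [Finset.mem_Ico, pow_succ]
    constructor <;> omega

/-- Convolution of two functions on `ℤ`. -/
noncomputable def convZ (K f : ℤ → ℂ) (n : ℤ) : ℂ := ∑' j : ℤ, K (n - j) * f j

lemma convZ_eq_sum (K f : ℤ → ℂ) (S : Finset ℤ) (hS : ∀ j ∉ S, f j = 0) (n : ℤ) :
    convZ K f n = ∑ j ∈ S, K (n - j) * f j :=
  tsum_eq_sum fun j hj => by rw [hS j hj, mul_zero]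

lemma convZ_add_of_finite (K f g : ℤ → ℂ) (hf : f.support.Finite) (hg : g.support.Finite)
    (n : ℤ) : convZ K (fun j => f j + g j) n = convZ K f n + convZ K g n := by
  classical
  have h1 : ∀ j ∉ hf.toFinset ∪ hg.toFinset, f j = 0 := fun j hj => by
    by_contra h; exact hj (by simp [h])
  have h2 : ∀ j ∉ hf.toFinset ∪ hg.toFinset, g j = 0 := fun j hj => by
    by_contra h; exact hj (by simp [h])
  rw [convZ_eq_sum K f _ h1, convZ_eq_sum K g _ h2,
    convZ_eq_sum K _ (hf.toFinset ∪ hg.toFinset) (fun j hj => by rw [h1 j hj, h2 j hj, add_zero]),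
    ← Finset.sum_add_distrib]
  exact Finset.sum_congr rfl fun _ _ => mul_add _ _ _

/-- Convolution with a Hörmander kernel of a mean-zero function supported in an interval is
summable away from that interval. -/
lemma tsum_convZ_away_le (K : ℤ → ℂ) (B : ENNReal)
    (hH : ∀ h : ℤ, ∑' n : ℤ, (if 2 * |h| ≤ |n| then ‖K (n - h) - K n‖ₑ else 0) ≤ B)
    (b : ℤ → ℂ) (c : ℤ) (l : ℕ) (hb : ∀ j ∉ Finset.Ico c (c + l), b j = 0)
    (hmean : ∑ j ∈ Finset.Ico c (c + l), b j = 0) :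
    ∑' n : ℤ, (if 2 * (l : ℤ) ≤ |n - c| then ‖convZ K b n‖ₑ else 0)
      ≤ B * ∑ j ∈ Finset.Ico c (c + l), ‖b j‖ₑ := by
  have key : ∀ n : ℤ, (if 2 * (l : ℤ) ≤ |n - c| then ‖convZ K b n‖ₑ else 0) ≤
      ∑ j ∈ Finset.Ico c (c + l), (if 2 * |j - c| ≤ |n - c| then
        ‖K ((n - c) - (j - c)) - K (n - c)‖ₑ else 0) * ‖b j‖ₑ := by
    intro n
    split_ifs with hn
    · have e : convZ K b n =
          ∑ j ∈ Finset.Ico c (c + l), (K ((n - c) - (j - c)) - K (n - c)) * b j := by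
        rw [convZ_eq_sum K b _ hb]
        simp only [sub_mul, Finset.sum_sub_distrib, ← Finset.mul_sum, hmean, mul_zero, sub_zero,
          sub_sub_sub_cancel_right]
      rw [e]
      refine (enorm_sum_le _ _).trans (Finset.sum_le_sum fun j hj => ?_)
      rw [enorm_mul, if_pos]
      rw [Finset.mem_Ico] at hj
      rw [abs_of_nonneg (by omega : 0 ≤ j - c)]
      omega
    · exact zero_le
  calc _ ≤ ∑' n : ℤ, ∑ j ∈ Finset.Ico c (c + l), (if 2 * |j - c| ≤ |n - c| then
        ‖K ((n - c) - (j - c)) - K (n - c)‖ₑ else 0) * ‖b j‖ₑ := ENNReal.tsum_le_tsum key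
    _ = ∑ j ∈ Finset.Ico c (c + l), ∑' n : ℤ, (if 2 * |j - c| ≤ |n - c| then
        ‖K ((n - c) - (j - c)) - K (n - c)‖ₑ else 0) * ‖b j‖ₑ :=
      Summable.tsum_finsetSum fun _ _ => ENNReal.summable
    _ ≤ ∑ j ∈ Finset.Ico c (c + l), B * ‖b j‖ₑ := by
      refine Finset.sum_le_sum fun j _ => ?_
      rw [ENNReal.tsum_mul_right]
      gcongr
      refine le_trans (le_of_eq ?_) (hH (j - c))
      exact (Equiv.subRight c).tsum_eq (fun n : ℤ => if 2 * |j - c| ≤ |n| then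
        ‖K (n - (j - c)) - K n‖ₑ else 0)
    _ = _ := by rw [Finset.mul_sum]

lemma mul_count_le_tsum (F : ℤ → ENNReal) (t : ENNReal) :
    t * Measure.count {n : ℤ | t ≤ F n} ≤ ∑' n, F n := by
  rw [← lintegral_count]
  exact mul_meas_ge_le_lintegral (measurable_of_countable F) t

/-- Weak type `(1,1)` bound for convolution with a Calderón–Zygmund kernel on `ℤ`. -/
lemma weak_type_one (K : ℤ → ℂ) (A B : ENNReal)
    (hL2 : ∀ f : ℤ → ℂ, f.support.Finite →
      ∑' n, ‖convZ K f n‖ₑ ^ 2 ≤ A * ∑' n, ‖f n‖ₑ ^ 2)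
    (hH : ∀ h : ℤ, ∑' n : ℤ, (if 2 * |h| ≤ |n| then ‖K (n - h) - K n‖ₑ else 0) ≤ B)
    (f : ℤ → ℂ) (hf : f.support.Finite) (lam : ℝ) (hlam : 0 < lam) :
    ENNReal.ofReal lam * Measure.count {n : ℤ | lam < ‖convZ K f n‖} ≤
      (4 + 24 * A + 4 * B) * ∑' n, ‖f n‖ₑ := by
  classical
  have hnf : (fun n => ‖f n‖).support.Finite := by simpa [Function.support] using hf
  obtain ⟨R, r2, r3, r4, r5, r6⟩ :=
    exists_calderon_zygmund_intervals (fun n => ‖f n‖) (fun _ => norm_nonneg _) hnf lam hlam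
  set I : ℤ × ℕ → Finset ℤ := fun r => Finset.Ico r.1 (r.1 + r.2) with hI
  have cardI : ∀ r, (I r).card = r.2 := fun r => by simp [hI]
  set avg : ℤ × ℕ → ℂ := fun r => (∑ j ∈ I r, f j) / r.2 with havg
  have havg_le : ∀ r ∈ R, r.2 * ‖avg r‖ ≤ ∑ j ∈ I r, ‖f j‖ := by
    intro r hr
    have : (0 : ℝ) < r.2 := by exact_mod_cast r2 r hr
    rw [havg]
    simp only [norm_div, Complex.norm_natCast]
    rw [mul_div_cancel₀ _ this.ne']
    exact norm_sum_le _ _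
  set b : ℤ × ℕ → ℤ → ℂ := fun r j => if j ∈ I r then f j - avg r else 0 with hb
  have hb0 : ∀ r, ∀ j ∉ I r, b r j = 0 := fun r j hj => if_neg hj
  have hbfin : ∀ r, (b r).support.Finite := fun r =>
    (I r).finite_toSet.subset fun j hj => by
      by_contra h; exact hj (hb0 r j h)
  have hbmean : ∀ r ∈ R, ∑ j ∈ I r, b r j = 0 := by
    intro r hr
    have : (r.2 : ℂ) ≠ 0 := by exact_mod_cast (Nat.one_le_iff_ne_zero.1 (r2 r hr))
    rw [Finset.sum_congr rfl (fun j hj => if_pos hj), Finset.sum_sub_distrib, Finset.sum_const,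
      cardI, nsmul_eq_mul, havg]
    simp only
    rw [mul_div_cancel₀ _ this, sub_self]
  set F1 : ENNReal := ∑' n, ‖f n‖ₑ with hF1
  have sumI : ∑ r ∈ R, ∑ j ∈ I r, ‖f j‖ₑ ≤ F1 := by
    rw [← Finset.sum_biUnion r3]
    exact ENNReal.sum_le_tsum _
  have hb1 : ∀ r ∈ R, ∑ j ∈ I r, ‖b r j‖ₑ ≤ 2 * ∑ j ∈ I r, ‖f j‖ₑ := by
    intro r hr
    have h1 : ∑ j ∈ I r, ‖b r j‖ ≤ 2 * ∑ j ∈ I r, ‖f j‖ := by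
      calc ∑ j ∈ I r, ‖b r j‖ ≤ ∑ j ∈ I r, (‖f j‖ + ‖avg r‖) :=
            Finset.sum_le_sum fun j hj => by rw [hb]; simp only [if_pos hj]; exact norm_sub_le _ _
        _ = ∑ j ∈ I r, ‖f j‖ + r.2 * ‖avg r‖ := by
            rw [Finset.sum_add_distrib, Finset.sum_const, cardI, nsmul_eq_mul]
        _ ≤ _ := by linarith [havg_le r hr]
    have h2 := ENNReal.ofReal_le_ofReal h1
    rw [ENNReal.ofReal_mul (by norm_num), ENNReal.ofReal_sum_of_nonneg (fun _ _ => norm_nonneg _),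
      ENNReal.ofReal_sum_of_nonneg (fun _ _ => norm_nonneg _)] at h2
    simpa [ofReal_norm] using h2
  set bt : ℤ → ℂ := fun j => ∑ r ∈ R, b r j with hbt
  set g : ℤ → ℂ := fun j => f j - bt j with hg
  have hbtfin : bt.support.Finite := by
    refine (R.biUnion I).finite_toSet.subset fun j hj => ?_
    by_contra h
    refine hj (Finset.sum_eq_zero fun r hr => hb0 r j fun hjr => h ?_)
    exact Finset.mem_coe.2 (Finset.mem_biUnion.2 ⟨r, hr, hjr⟩)
  have hgfin : g.support.Finite := (hf.union hbtfin).subset (Function.support_sub _ _)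
  have hg2 : ∀ n, ‖g n‖ ≤ 2 * lam := by
    intro n
    by_cases h : ∃ r ∈ R, n ∈ I r
    · obtain ⟨r, hr, hn⟩ := h
      have e : bt n = f n - avg r := by
        rw [hbt]
        simp only
        rw [Finset.sum_eq_single_of_mem r hr, hb]
        · simp only [if_pos hn]
        · intro t ht htr
          refine hb0 t n fun hnt => ?_
          exact (Finset.disjoint_left.1 (r3 ht hr htr)) hnt hn
      have e2 : g n = avg r := by rw [hg]; simp only [e]; ring
      have h3 : (0 : ℝ) < r.2 := by exact_mod_cast r2 r hr
      have h4 := (havg_le r hr).trans (r5 r hr)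
      rw [e2]
      have h5 : (r.2 : ℝ) * ‖avg r‖ ≤ r.2 * (2 * lam) := by linarith
      exact le_of_mul_le_mul_left h5 h3
    · push Not at h
      have e : g n = f n := by
        rw [hg, hbt]
        simp only
        rw [Finset.sum_eq_zero fun r hr => hb0 r n (h r hr), sub_zero]
      rw [e]
      linarith [r6 n h]
  have hbt1 : ∑' n, ‖bt n‖ₑ ≤ 2 * F1 := by
    calc ∑' n, ‖bt n‖ₑ ≤ ∑' n, ∑ r ∈ R, ‖b r n‖ₑ :=
          ENNReal.tsum_le_tsum fun n => enorm_sum_le _ _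
      _ = ∑ r ∈ R, ∑' n, ‖b r n‖ₑ := Summable.tsum_finsetSum fun _ _ => ENNReal.summable
      _ = ∑ r ∈ R, ∑ n ∈ I r, ‖b r n‖ₑ := Finset.sum_congr rfl fun r _ =>
          tsum_eq_sum fun j hj => by rw [hb0 r j hj, enorm_zero]
      _ ≤ ∑ r ∈ R, 2 * ∑ n ∈ I r, ‖f n‖ₑ := Finset.sum_le_sum hb1
      _ ≤ 2 * F1 := by rw [← Finset.mul_sum]; gcongr
  have hg1 : ∑' n, ‖g n‖ₑ ≤ 3 * F1 := by
    calc ∑' n, ‖g n‖ₑ ≤ ∑' n, (‖f n‖ₑ + ‖bt n‖ₑ) :=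
          ENNReal.tsum_le_tsum fun n => enorm_sub_le
      _ = F1 + ∑' n, ‖bt n‖ₑ := ENNReal.tsum_add
      _ ≤ F1 + 2 * F1 := by gcongr
      _ = 3 * F1 := by ring
  have hlam0 : ENNReal.ofReal lam ≠ 0 := by simpa using hlam
  set L := ENNReal.ofReal lam with hL
  have hLtop : L ≠ ⊤ := ENNReal.ofReal_ne_top
  have h2L : ENNReal.ofReal (2 * lam) = 2 * L := by
    rw [ENNReal.ofReal_mul (by norm_num)]; simp [hL]
  have hgsq : ∑' n, ‖g n‖ₑ ^ 2 ≤ 2 * L * (3 * F1) := by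
    calc ∑' n, ‖g n‖ₑ ^ 2 ≤ ∑' n, 2 * L * ‖g n‖ₑ := by
          refine ENNReal.tsum_le_tsum fun n => ?_
          rw [pow_two]
          gcongr
          rw [← h2L, ← ofReal_norm]
          exact ENNReal.ofReal_le_ofReal (hg2 n)
      _ = 2 * L * ∑' n, ‖g n‖ₑ := ENNReal.tsum_mul_left
      _ ≤ _ := by gcongr
  -- the three exceptional sets
  set E : Finset ℤ := R.biUnion fun r => Finset.Ico (r.1 - 2 * r.2) (r.1 + 2 * r.2) with hE
  set G : ℤ → ENNReal := fun n => ∑ r ∈ R,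
    (if 2 * (r.2 : ℤ) ≤ |n - r.1| then ‖convZ K (b r) n‖ₑ else 0) with hG
  have sumG : ∑' n, G n ≤ 2 * B * F1 := by
    calc ∑' n, G n = ∑ r ∈ R, ∑' n : ℤ,
          (if 2 * (r.2 : ℤ) ≤ |n - r.1| then ‖convZ K (b r) n‖ₑ else 0) :=
          Summable.tsum_finsetSum fun _ _ => ENNReal.summable
      _ ≤ ∑ r ∈ R, B * ∑ j ∈ I r, ‖b r j‖ₑ := Finset.sum_le_sum fun r hr =>
          tsum_convZ_away_le K B hH (b r) r.1 r.2 (hb0 r) (hbmean r hr)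
      _ ≤ ∑ r ∈ R, B * (2 * ∑ j ∈ I r, ‖f j‖ₑ) := by
          gcongr with r hr
          exact hb1 r hr
      _ = 2 * B * ∑ r ∈ R, ∑ j ∈ I r, ‖f j‖ₑ := by
          rw [Finset.mul_sum]
          exact Finset.sum_congr rfl fun _ _ => by ring
      _ ≤ _ := by gcongr
  have hTbt : ∀ n, convZ K bt n = ∑ r ∈ R, convZ K (b r) n := by
    intro n
    have hS : ∀ r ∈ R, ∀ j ∉ R.biUnion I, b r j = 0 := fun r hr j hj =>
      hb0 r j fun h => hj (Finset.mem_biUnion.2 ⟨r, hr, h⟩)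
    rw [convZ_eq_sum K bt (R.biUnion I) (fun j hj => Finset.sum_eq_zero fun r hr => hS r hr j hj),
      Finset.sum_congr rfl fun r hr => convZ_eq_sum K (b r) (R.biUnion I) (hS r hr) n,
      Finset.sum_comm]
    exact Finset.sum_congr rfl fun j _ => Finset.mul_sum _ _ _
  have hTbtG : ∀ n ∉ E, ‖convZ K bt n‖ₑ ≤ G n := by
    intro n hn
    rw [hTbt]
    refine (enorm_sum_le _ _).trans (Finset.sum_le_sum fun r hr => ?_)
    rw [if_pos]
    by_contra hlt
    refine hn (Finset.mem_biUnion.2 ⟨r, hr, ?_⟩)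
    have := abs_lt.1 (not_le.1 hlt)
    rw [Finset.mem_Ico]
    constructor <;> omega
  have hTf : ∀ n, convZ K f n = convZ K g n + convZ K bt n := by
    intro n
    rw [← convZ_add_of_finite K g bt hgfin hbtfin]
    congr 1
    funext j
    rw [hg]
    simp only [sub_add_cancel]
  have hcover : {n : ℤ | lam < ‖convZ K f n‖} ⊆
      (E : Set ℤ) ∪ ({n | (L / 2) ^ 2 ≤ ‖convZ K g n‖ₑ ^ 2} ∪ {n | L / 2 ≤ G n}) := by
    intro n hn
    by_contra h
    simp only [Set.mem_union, Finset.mem_coe, Set.mem_ofPred_eq, not_or, not_le] at h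
    obtain ⟨hnE, hng, hnG⟩ := h
    have hng' : ‖convZ K g n‖ₑ < L / 2 := by
      by_contra hle
      exact absurd hng (not_lt.2 (pow_le_pow_left' (not_lt.1 hle) 2))
    have h1 : ‖convZ K f n‖ₑ < L / 2 + L / 2 := by
      rw [hTf]
      exact (enorm_add_le _ _).trans_lt (ENNReal.add_lt_add hng' ((hTbtG n hnE).trans_lt hnG))
    rw [ENNReal.add_halves, ← ofReal_norm, hL,
      ENNReal.ofReal_lt_ofReal_iff hlam] at h1
    exact absurd hn (not_lt.2 h1.le)
  have cE : L * Measure.count (E : Set ℤ) ≤ 4 * F1 := by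
    rw [Measure.count_apply_finset]
    have h1 : (E.card : ENNReal) ≤ ∑ r ∈ R, (4 * r.2 : ENNReal) := by
      have : E.card ≤ ∑ r ∈ R, 4 * r.2 := by
        refine Finset.card_biUnion_le.trans (Finset.sum_le_sum fun r _ => ?_)
        rw [Int.card_Ico]; omega
      exact_mod_cast this
    calc L * (E.card : ENNReal) ≤ L * ∑ r ∈ R, (4 * r.2 : ENNReal) := by gcongr
      _ = 4 * ∑ r ∈ R, L * r.2 := by
        simp only [Finset.mul_sum]
        exact Finset.sum_congr rfl fun _ _ => by ring
      _ ≤ 4 * ∑ r ∈ R, ∑ j ∈ I r, ‖f j‖ₑ := by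
        gcongr with r hr
        have h2 := ENNReal.ofReal_le_ofReal (r4 r hr).le
        rw [ENNReal.ofReal_mul hlam.le, ENNReal.ofReal_natCast,
          ENNReal.ofReal_sum_of_nonneg (fun _ _ => norm_nonneg _)] at h2
        simpa [ofReal_norm] using h2
      _ ≤ _ := by gcongr
  have cg : L * Measure.count {n | (L / 2) ^ 2 ≤ ‖convZ K g n‖ₑ ^ 2} ≤ 24 * A * F1 := by
    have h1 := (mul_count_le_tsum (fun n => ‖convZ K g n‖ₑ ^ 2) ((L / 2) ^ 2)).trans
      ((hL2 g hgfin).trans (mul_le_mul_right hgsq A))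
    have h3 : L * (L * Measure.count {n | (L / 2) ^ 2 ≤ ‖convZ K g n‖ₑ ^ 2}) ≤
        L * (24 * A * F1) := by
      have e4 : (4 : ENNReal) * (L / 2) ^ 2 = L * L := by
        have : (2 : ENNReal) * (L / 2) = L := ENNReal.mul_div_cancel (by norm_num) (by norm_num)
        calc (4 : ENNReal) * (L / 2) ^ 2 = (2 * (L / 2)) * (2 * (L / 2)) := by ring
          _ = L * L := by rw [this]
      calc _ = 4 * ((L / 2) ^ 2 * Measure.count {n | (L / 2) ^ 2 ≤ ‖convZ K g n‖ₑ ^ 2}) := by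
            rw [← mul_assoc, ← mul_assoc, e4]
        _ ≤ 4 * (A * (2 * L * (3 * F1))) := by gcongr
        _ = _ := by ring
    exact (ENNReal.mul_le_mul_iff_right hlam0 hLtop).1 h3
  have cb : L * Measure.count {n | L / 2 ≤ G n} ≤ 4 * B * F1 := by
    have e2 : (2 : ENNReal) * (L / 2) = L := ENNReal.mul_div_cancel (by norm_num) (by norm_num)
    calc _ = 2 * (L / 2 * Measure.count {n | L / 2 ≤ G n}) := by rw [← mul_assoc, e2]
      _ ≤ 2 * (2 * B * F1) := by exact mul_le_mul_right ((mul_count_le_tsum G _).trans sumG) 2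
      _ = _ := by ring
  calc L * Measure.count {n : ℤ | lam < ‖convZ K f n‖}
      ≤ L * (Measure.count (E : Set ℤ) + (Measure.count {n | (L / 2) ^ 2 ≤ ‖convZ K g n‖ₑ ^ 2}
        + Measure.count {n | L / 2 ≤ G n})) := by
        gcongr
        exact (measure_mono hcover).trans ((measure_union_le _ _).trans
          (by gcongr; exact measure_union_le _ _))
    _ = L * Measure.count (E : Set ℤ) + (L * Measure.count {n | (L / 2) ^ 2 ≤ ‖convZ K g n‖ₑ ^ 2}
        + L * Measure.count {n | L / 2 ≤ G n}) := by ring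
    _ ≤ 4 * F1 + (24 * A * F1 + 4 * B * F1) := by gcongr
    _ = _ := by ring

lemma lintegral_indicator_rpow_low (p x : ℝ) (hp : 1 < p) (hx : 0 < x) :
    ∫⁻ t in Set.Ioi (0 : ℝ), (Set.Iio x).indicator (fun t => ENNReal.ofReal (x * t ^ (p - 2))) t
      = ENNReal.ofReal (1 / (p - 1)) * ENNReal.ofReal (x ^ p) := by
  rw [lintegral_indicator measurableSet_Iio, Measure.restrict_restrict measurableSet_Iio,
    Set.inter_comm, Set.Ioi_inter_Iio, ← ENNReal.ofReal_mul (by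
      have : 0 < p - 1 := by linarith
      positivity),
    ← ofReal_integral_eq_lintegral_ofReal]
  · congr 1
    rw [integral_const_mul, ← integral_Ioc_eq_integral_Ioo, ← intervalIntegral.integral_of_le hx.le,
      integral_rpow (Or.inl (by linarith)), Real.zero_rpow (by linarith)]
    have : x ^ p = x * x ^ (p - 1) := by
      rw [Real.rpow_sub_one hx.ne']; field_simp
    rw [this, show p - 2 + 1 = p - 1 by ring]
    ring
  · have h := (intervalIntegral.intervalIntegrable_rpow' (a := 0) (b := x) (r := p - 2)
      (by linarith)).const_mul x
    rw [intervalIntegrable_iff_integrableOn_Ioo_of_le hx.le] at h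
    exact h
  · filter_upwards [ae_restrict_mem measurableSet_Ioo] with t ht
    have := ht.1
    positivity

lemma lintegral_indicator_rpow_high (p x : ℝ) (hp : p < 2) (hx : 0 < x) :
    ∫⁻ t in Set.Ioi (0 : ℝ), (Set.Ici x).indicator (fun t => ENNReal.ofReal (x ^ 2 * t ^ (p - 3))) t
      = ENNReal.ofReal (1 / (2 - p)) * ENNReal.ofReal (x ^ p) := by
  have e : Set.Ici x ∩ Set.Ioi 0 = Set.Ici x :=
    Set.inter_eq_left.2 fun t ht => lt_of_lt_of_le hx ht
  rw [lintegral_indicator measurableSet_Ici, Measure.restrict_restrict measurableSet_Ici, e,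
    setLIntegral_congr Ioi_ae_eq_Ici.symm,
    ← ENNReal.ofReal_mul (by
      have : 0 < 2 - p := by linarith
      positivity),
    ← ofReal_integral_eq_lintegral_ofReal]
  · congr 1
    rw [integral_const_mul, integral_Ioi_rpow_of_lt (by linarith) hx]
    have : x ^ p = x ^ 2 * x ^ (p - 2) := by
      rw [← Real.rpow_natCast, ← Real.rpow_add hx]; congr 1; push_cast; ring
    have h2 : 2 - p ≠ 0 := by linarith
    have h3 : p - 2 ≠ 0 := by linarith
    rw [this, show p - 3 + 1 = p - 2 by ring]
    field_simp
    ring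
  · exact (integrableOn_Ioi_rpow_of_lt (by linarith) hx).const_mul _
  · filter_upwards [ae_restrict_mem measurableSet_Ioi] with t ht
    have : 0 < t := lt_trans hx ht
    positivity

/-- Marcinkiewicz interpolation: weak `(1,1)` and strong `(2,2)` bounds for a convolution operator
give strong `(p,p)` bounds for `1 < p < 2`. -/
lemma strong_type_of_weak_type (K : ℤ → ℂ) (A W : ENNReal)
    (hL2 : ∀ f : ℤ → ℂ, f.support.Finite →
      ∑' n, ‖convZ K f n‖ₑ ^ 2 ≤ A * ∑' n, ‖f n‖ₑ ^ 2)
    (hW : ∀ f : ℤ → ℂ, f.support.Finite → ∀ lam : ℝ, 0 < lam →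
      ENNReal.ofReal lam * Measure.count {n : ℤ | lam < ‖convZ K f n‖} ≤ W * ∑' n, ‖f n‖ₑ)
    (p : ℝ) (hp1 : 1 < p) (hp2 : p < 2) (f : ℤ → ℂ) (hf : f.support.Finite) :
    ∑' n, ‖convZ K f n‖ₑ ^ p ≤ ENNReal.ofReal p * (2 * W * ENNReal.ofReal (1 / (p - 1)) +
      4 * A * ENNReal.ofReal (1 / (2 - p))) * ∑' n, ‖f n‖ₑ ^ p := by
  classical
  have hp0 : 0 < p := by linarith
  set S := hf.toFinset with hS
  have hS0 : ∀ j ∉ S, f j = 0 := fun j hj => by simpa [hS] using hj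
  have hSpos : ∀ j ∈ S, 0 < ‖f j‖ := fun j hj => by
    rw [norm_pos_iff]; simpa [hS] using hj
  have dist : ∀ t : ℝ, 0 < t →
      Measure.count {n : ℤ | t < ‖convZ K f n‖} * ENNReal.ofReal (t ^ (p - 1)) ≤
      ∑ j ∈ S, (2 * W * (Set.Iio ‖f j‖).indicator
          (fun t => ENNReal.ofReal (‖f j‖ * t ^ (p - 2))) t +
        4 * A * (Set.Ici ‖f j‖).indicator
          (fun t => ENNReal.ofReal (‖f j‖ ^ 2 * t ^ (p - 3))) t) := by
    intro t ht
    set f1 : ℤ → ℂ := fun j => if t < ‖f j‖ then f j else 0 with hf1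
    set f2 : ℤ → ℂ := fun j => if t < ‖f j‖ then 0 else f j with hf2
    have hf1S : ∀ j ∉ S, f1 j = 0 := fun j hj => by simp [hf1, hS0 j hj]
    have hf2S : ∀ j ∉ S, f2 j = 0 := fun j hj => by simp [hf2, hS0 j hj]
    have hf1fin : f1.support.Finite := S.finite_toSet.subset fun j hj => by
      by_contra h; exact hj (hf1S j h)
    have hf2fin : f2.support.Finite := S.finite_toSet.subset fun j hj => by
      by_contra h; exact hj (hf2S j h)
    have hT : ∀ n, convZ K f n = convZ K f1 n + convZ K f2 n := by
      intro n
      rw [← convZ_add_of_finite K f1 f2 hf1fin hf2fin]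
      congr 1
      funext j
      simp only [hf1, hf2]
      split_ifs <;> simp
    set L := ENNReal.ofReal (t / 2) with hL
    have hL0 : L ≠ 0 := by simpa [hL] using ht
    have hLtop : L ≠ ⊤ := ENNReal.ofReal_ne_top
    have hcover : {n : ℤ | t < ‖convZ K f n‖} ⊆
        {n | t / 2 < ‖convZ K f1 n‖} ∪ {n | L ^ 2 ≤ ‖convZ K f2 n‖ₑ ^ 2} := by
      intro n hn
      by_contra h
      simp only [Set.mem_union, Set.mem_ofPred_eq, not_or, not_lt, not_le] at h
      have h2 : ‖convZ K f2 n‖ < t / 2 := by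
        by_contra hle
        refine absurd h.2 (not_lt.2 (pow_le_pow_left' ?_ 2))
        rw [hL, ← ofReal_norm]
        exact ENNReal.ofReal_le_ofReal (not_lt.1 hle)
      have h3 : t < ‖convZ K f n‖ := hn
      rw [hT] at h3
      linarith [norm_add_le (convZ K f1 n) (convZ K f2 n), h.1]
    have c1 : Measure.count {n | t / 2 < ‖convZ K f1 n‖} ≤ L⁻¹ * (W * ∑' n, ‖f1 n‖ₑ) := by
      rw [mul_comm L⁻¹, ← div_eq_mul_inv, ENNReal.le_div_iff_mul_le (Or.inl hL0) (Or.inl hLtop),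
        mul_comm]
      exact hW f1 hf1fin (t / 2) (by positivity)
    have c2 : Measure.count {n | L ^ 2 ≤ ‖convZ K f2 n‖ₑ ^ 2} ≤
        (L ^ 2)⁻¹ * (A * ∑' n, ‖f2 n‖ₑ ^ 2) := by
      rw [mul_comm (L ^ 2)⁻¹, ← div_eq_mul_inv, ENNReal.le_div_iff_mul_le
        (Or.inl (pow_ne_zero 2 hL0)) (Or.inl (ENNReal.pow_ne_top hLtop)), mul_comm]
      exact (mul_count_le_tsum _ _).trans (hL2 f2 hf2fin)
    have e1 : ∑' n, ‖f1 n‖ₑ = ∑ j ∈ S, ‖f1 j‖ₑ :=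
      tsum_eq_sum fun j hj => by rw [hf1S j hj, enorm_zero]
    have e2 : ∑' n, ‖f2 n‖ₑ ^ 2 = ∑ j ∈ S, ‖f2 j‖ₑ ^ 2 :=
      tsum_eq_sum fun j hj => by rw [hf2S j hj, enorm_zero]; simp
    have hLinv : L⁻¹ = ENNReal.ofReal (2 * t⁻¹) := by
      rw [hL, ← ENNReal.ofReal_inv_of_pos (by positivity)]
      congr 1
      field_simp
    have t1 : ∀ j, L⁻¹ * ‖f1 j‖ₑ * ENNReal.ofReal (t ^ (p - 1)) = 2 * (Set.Iio ‖f j‖).indicator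
        (fun t => ENNReal.ofReal (‖f j‖ * t ^ (p - 2))) t := by
      intro j
      by_cases h : t < ‖f j‖
      · rw [Set.indicator_of_mem (show t ∈ Set.Iio ‖f j‖ from h), hLinv, ← ofReal_norm,
          ← ENNReal.ofReal_mul (by positivity), ← ENNReal.ofReal_mul (by positivity),
          ← ENNReal.ofReal_ofNat 2, ← ENNReal.ofReal_mul (by positivity)]
        congr 1
        simp only [hf1, if_pos h]
        have : t ^ (p - 1) = t * t ^ (p - 2) := by
          rw [show p - 1 = 1 + (p - 2) by ring, Real.rpow_add ht, Real.rpow_one]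
        rw [this]
        field_simp
      · rw [Set.indicator_of_notMem (show t ∉ Set.Iio ‖f j‖ from h)]
        simp [hf1, h]
    have t2 : ∀ j, (L ^ 2)⁻¹ * ‖f2 j‖ₑ ^ 2 * ENNReal.ofReal (t ^ (p - 1)) =
        4 * (Set.Ici ‖f j‖).indicator
        (fun t => ENNReal.ofReal (‖f j‖ ^ 2 * t ^ (p - 3))) t := by
      intro j
      by_cases h : t < ‖f j‖
      · rw [Set.indicator_of_notMem (show t ∉ Set.Ici ‖f j‖ from not_le.2 h)]
        simp [hf2, h]
      · rw [Set.indicator_of_mem (show t ∈ Set.Ici ‖f j‖ from not_lt.1 h), ENNReal.inv_pow, hLinv,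
          ← ofReal_norm,
          ← ENNReal.ofReal_pow (by positivity), ← ENNReal.ofReal_pow (by positivity),
          ← ENNReal.ofReal_mul (by positivity), ← ENNReal.ofReal_mul (by positivity),
          ← ENNReal.ofReal_ofNat 4, ← ENNReal.ofReal_mul (by positivity)]
        congr 1
        simp only [hf2, if_neg h]
        have : t ^ (p - 1) = t ^ 2 * t ^ (p - 3) := by
          rw [show p - 1 = (2 : ℕ) + (p - 3) by push_cast; ring, Real.rpow_add ht,
            Real.rpow_natCast]
        rw [this]
        field_simp
        ring
    calc Measure.count {n : ℤ | t < ‖convZ K f n‖} * ENNReal.ofReal (t ^ (p - 1))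
        ≤ (L⁻¹ * (W * ∑' n, ‖f1 n‖ₑ) + (L ^ 2)⁻¹ * (A * ∑' n, ‖f2 n‖ₑ ^ 2)) *
          ENNReal.ofReal (t ^ (p - 1)) := by
          gcongr
          exact (measure_mono hcover).trans ((measure_union_le _ _).trans (add_le_add c1 c2))
      _ = ∑ j ∈ S, (W * (L⁻¹ * ‖f1 j‖ₑ * ENNReal.ofReal (t ^ (p - 1))) +
          A * ((L ^ 2)⁻¹ * ‖f2 j‖ₑ ^ 2 * ENNReal.ofReal (t ^ (p - 1)))) := by
          rw [e1, e2, Finset.sum_add_distrib, add_mul]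
          simp only [Finset.mul_sum, Finset.sum_mul]
          congr 1 <;> exact Finset.sum_congr rfl fun _ _ => by ring
      _ = _ := by
          refine Finset.sum_congr rfl fun j _ => ?_
          rw [t1, t2]
          ring
  have layer := lintegral_rpow_eq_lintegral_meas_lt_mul (Measure.count : Measure ℤ)
    (f := fun n => ‖convZ K f n‖) (Filter.Eventually.of_forall fun _ => norm_nonneg _)
    (measurable_of_countable _).aemeasurable hp0
  have hof : ∀ z : ℂ, ENNReal.ofReal (‖z‖ ^ p) = ‖z‖ₑ ^ p := fun z => by
    rw [← ENNReal.ofReal_rpow_of_nonneg (norm_nonneg _) hp0.le, ofReal_norm]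
  simp only [lintegral_count, hof] at layer
  rw [layer, mul_assoc]
  gcongr
  have m1 : ∀ j, Measurable ((Set.Iio ‖f j‖).indicator
      (fun t : ℝ => ENNReal.ofReal (‖f j‖ * t ^ (p - 2)))) := fun j =>
    (by fun_prop : Measurable fun t : ℝ => ENNReal.ofReal (‖f j‖ * t ^ (p - 2))).indicator
      measurableSet_Iio
  have m2 : ∀ j, Measurable ((Set.Ici ‖f j‖).indicator
      (fun t : ℝ => ENNReal.ofReal (‖f j‖ ^ 2 * t ^ (p - 3)))) := fun j =>
    (by fun_prop : Measurable fun t : ℝ => ENNReal.ofReal (‖f j‖ ^ 2 * t ^ (p - 3))).indicator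
      measurableSet_Ici
  calc _ ≤ ∫⁻ t in Set.Ioi (0 : ℝ), ∑ j ∈ S, (2 * W * (Set.Iio ‖f j‖).indicator
          (fun t => ENNReal.ofReal (‖f j‖ * t ^ (p - 2))) t +
        4 * A * (Set.Ici ‖f j‖).indicator
          (fun t => ENNReal.ofReal (‖f j‖ ^ 2 * t ^ (p - 3))) t) :=
        setLIntegral_mono' measurableSet_Ioi fun t ht => dist t ht
    _ = ∑ j ∈ S, (2 * W * ENNReal.ofReal (1 / (p - 1)) +
          4 * A * ENNReal.ofReal (1 / (2 - p))) * ‖f j‖ₑ ^ p := by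
        rw [lintegral_finsetSum]
        swap
        · exact fun j _ => ((m1 j).const_mul (2 * W)).add ((m2 j).const_mul (4 * A))
        refine Finset.sum_congr rfl fun j hj => ?_
        rw [lintegral_add_left ((m1 j).const_mul (2 * W)), lintegral_const_mul _ (m1 j),
          lintegral_const_mul _ (m2 j), lintegral_indicator_rpow_low p _ hp1 (hSpos j hj),
          lintegral_indicator_rpow_high p _ hp2 (hSpos j hj), hof]
        ring
    _ ≤ _ := by
        rw [← Finset.mul_sum]
        gcongr
        exact ENNReal.sum_le_tsum _

/-- The `ℓ^p` quantity `(∑ ‖f n‖ ^ p) ^ (1 / p)`. -/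
lemma lpNormZ_eq (f : ℤ → ℂ) {p : ℝ} (hp : 0 < p) :
    lpNormZ f p = (∑' n, ‖f n‖ₑ ^ p) ^ (1 / p) := by
  rw [lpNormZ, eLpNorm_eq_lintegral_rpow_enorm_toReal (by simpa using hp) ENNReal.ofReal_ne_top,
    ENNReal.toReal_ofReal hp.le, lintegral_count]

lemma summable_conv {K f : ℤ → ℂ} {M : ℝ} (hK : ∀ n, ‖K n‖ ≤ M) (hf : Summable fun n => ‖f n‖)
    (n : ℤ) : Summable fun j => K (n - j) * f j := by
  refine Summable.of_norm_bounded (hf.mul_left M) fun j => ?_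
  rw [norm_mul]
  exact mul_le_mul_of_nonneg_right (hK _) (norm_nonneg _)

/-- Duality: an `ℓ^p` bound for the reflected kernel on finitely supported functions gives the
conjugate `ℓ^q` bound on summable functions. -/
lemma convZ_bound_of_dual (K : ℤ → ℂ) (M : ℝ) (hK : ∀ n, ‖K n‖ ≤ M) (p q : ℝ)
    (hpq : p.HolderConjugate q) (C : ENNReal)
    (hC : ∀ g : ℤ → ℂ, g.support.Finite →
      lpNormZ (convZ (fun n => K (-n)) g) p ≤ C * lpNormZ g p)
    (f : ℤ → ℂ) (hf : Summable fun n => ‖f n‖) :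
    lpNormZ (convZ K f) q ≤ C * lpNormZ f q := by
  classical
  have hp0 : 0 < p := hpq.pos
  have hq0 : 0 < q := hpq.symm.pos
  rw [lpNormZ_eq _ hq0, one_div, ENNReal.rpow_inv_le_iff hq0, ENNReal.tsum_eq_iSup_sum]
  refine iSup_le fun S => ?_
  rw [← ENNReal.rpow_inv_le_iff hq0]
  set T := convZ K f with hT
  set X : ENNReal := ∑ n ∈ S, ‖T n‖ₑ ^ q with hX
  set g : ℤ → ℂ := fun n => if n ∈ S then
    (starRingEnd ℂ) (T n) * ((‖T n‖ ^ (q - 2) : ℝ) : ℂ) else 0 with hg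
  have hg0 : ∀ n ∉ S, g n = 0 := fun n hn => if_neg hn
  have hgfin : g.support.Finite := S.finite_toSet.subset fun n hn => by
    by_contra h; exact hn (hg0 n h)
  have hTg : ∀ n ∈ S, T n * g n = ((‖T n‖ ^ q : ℝ) : ℂ) := by
    intro n hn
    simp only [hg, if_pos hn]
    rw [← mul_assoc, Complex.mul_conj, Complex.normSq_eq_norm_sq, ← Complex.ofReal_mul]
    congr 1
    by_cases h : ‖T n‖ = 0
    · rw [h, Real.zero_rpow hq0.ne']; ring
    · rw [← Real.rpow_natCast, ← Real.rpow_add (lt_of_le_of_ne (norm_nonneg _) (Ne.symm h))]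
      congr 1; push_cast; ring
  have hgn : ∀ n ∈ S, ‖g n‖ₑ ^ p = ‖T n‖ₑ ^ q := by
    intro n hn
    have h1 : ‖g n‖ = ‖T n‖ ^ (q - 1) := by
      by_cases h : ‖T n‖ = 0
      · have : g n = 0 := by simp [hg, norm_eq_zero.1 h]
        rw [this, h, Real.zero_rpow (by have := hpq.symm.lt; linarith), norm_zero]
      · simp only [hg, if_pos hn, norm_mul, RCLike.norm_conj, Complex.norm_real]
        rw [Real.norm_of_nonneg (by positivity), show q - 1 = 1 + (q - 2) by ring,
          Real.rpow_add (lt_of_le_of_ne (norm_nonneg _) (Ne.symm h)), Real.rpow_one]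
    rw [← ofReal_norm, h1, ENNReal.ofReal_rpow_of_nonneg (by positivity) hp0.le,
      ← Real.rpow_mul (norm_nonneg _), ← ofReal_norm,
      ENNReal.ofReal_rpow_of_nonneg (norm_nonneg _) hq0.le]
    congr 2
    have := hpq.symm.sub_one_mul_conj
    linarith
  have hgN : lpNormZ g p = X ^ p⁻¹ := by
    rw [lpNormZ_eq _ hp0, one_div, tsum_eq_sum (s := S) fun n hn => by
      rw [hg0 n hn, enorm_zero, ENNReal.zero_rpow_of_pos hp0], Finset.sum_congr rfl hgn]
  have pair : ∑ n ∈ S, T n * g n = ∑' j, f j * convZ (fun n => K (-n)) g j := by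
    have e1 : ∀ n ∈ S, T n * g n = ∑' j, K (n - j) * f j * g n := fun n _ => by
      rw [tsum_mul_right]; rfl
    rw [Finset.sum_congr rfl e1, ← Summable.tsum_finsetSum fun n _ =>
      (summable_conv hK hf n).mul_right _]
    refine tsum_congr fun j => ?_
    rw [convZ_eq_sum _ g S hg0, Finset.mul_sum]
    refine Finset.sum_congr rfl fun n _ => ?_
    rw [neg_sub]; ring
  have hXeq : X = ‖∑ n ∈ S, T n * g n‖ₑ := by
    rw [Finset.sum_congr rfl hTg, ← Complex.ofReal_sum, ← ofReal_norm, Complex.norm_real,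
      Real.norm_of_nonneg (Finset.sum_nonneg fun _ _ => by positivity),
      ENNReal.ofReal_sum_of_nonneg (fun _ _ => by positivity)]
    refine Finset.sum_congr rfl fun n _ => ?_
    rw [← ENNReal.ofReal_rpow_of_nonneg (norm_nonneg _) hq0.le, ofReal_norm]
  have hXle : X ≤ C * lpNormZ f q * X ^ p⁻¹ := by
    calc X = ‖∑' j, f j * convZ (fun n => K (-n)) g j‖ₑ := by rw [hXeq, pair]
      _ ≤ ∑' j, ‖f j * convZ (fun n => K (-n)) g j‖ₑ := enorm_tsum_le_tsum_enorm
      _ = ∫⁻ j, ((fun j => ‖f j‖ₑ) * fun j => ‖convZ (fun n => K (-n)) g j‖ₑ) j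
            ∂(Measure.count : Measure ℤ) := by
          rw [lintegral_count]; simp [enorm_mul]
      _ ≤ lpNormZ f q * lpNormZ (convZ (fun n => K (-n)) g) p := by
          rw [lpNormZ_eq _ hp0, lpNormZ_eq _ hq0]
          have := ENNReal.lintegral_mul_le_Lp_mul_Lq (Measure.count : Measure ℤ) hpq.symm
            (f := fun j => ‖f j‖ₑ) (g := fun j => ‖convZ (fun n => K (-n)) g j‖ₑ)
            (measurable_of_countable _).aemeasurable (measurable_of_countable _).aemeasurable
          simpa only [lintegral_count] using this
      _ ≤ lpNormZ f q * (C * lpNormZ g p) := by gcongr; exact hC g hgfin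
      _ = _ := by rw [hgN]; ring
  have hXtop : X ≠ ⊤ := by
    rw [hXeq]; exact enorm_ne_top
  by_cases hX0 : X = 0
  · rw [hX0, ENNReal.zero_rpow_of_pos (by positivity)]; exact zero_le
  have h1 : X ^ p⁻¹ ≠ 0 := by simp [ENNReal.rpow_eq_zero_iff, hX0, hXtop]
  have h2 : X ^ p⁻¹ ≠ ⊤ := ENNReal.rpow_ne_top_of_nonneg (by positivity) hXtop
  have h3 : X ^ q⁻¹ * X ^ p⁻¹ = X := by
    rw [← ENNReal.rpow_add _ _ hX0 hXtop, add_comm, hpq.inv_add_inv_eq_one, ENNReal.rpow_one]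
  rw [← ENNReal.mul_le_mul_iff_left h1 h2, h3]
  exact hXle

/-- Convolution with `K` is bounded on `ℓ^p(ℤ)` (tested on summable functions). -/
def ConvBounded (K : ℤ → ℂ) (p : ℝ) : Prop :=
  ∃ C : NNReal, ∀ f : ℤ → ℂ, Summable (fun n => ‖f n‖) →
    lpNormZ (convZ K f) p ≤ C * lpNormZ f p

lemma lpNormZ_comp_neg (f : ℤ → ℂ) {p : ℝ} (hp : 0 < p) :
    lpNormZ (fun n => f (-n)) p = lpNormZ f p := by
  rw [lpNormZ_eq _ hp, lpNormZ_eq _ hp]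
  congr 1
  exact (Equiv.neg ℤ).tsum_eq fun n => ‖f n‖ₑ ^ p

lemma ConvBounded.comp_neg {K : ℤ → ℂ} {p : ℝ} (hp : 0 < p) (h : ConvBounded K p) :
    ConvBounded (fun n => K (-n)) p := by
  obtain ⟨C, hC⟩ := h
  refine ⟨C, fun f hf => ?_⟩
  have h1 := hC (fun n => f (-n)) ((Equiv.neg ℤ).summable_iff.2 hf)
  rw [lpNormZ_comp_neg f hp, ← lpNormZ_comp_neg _ hp] at h1
  convert h1 using 2
  funext n
  rw [convZ, convZ, ← (Equiv.neg ℤ).tsum_eq]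
  refine tsum_congr fun j => ?_
  simp only [Equiv.neg_apply]
  congr 2
  ring

lemma lpNormZ_congr_norm {f g : ℤ → ℂ} (h : ∀ n, ‖f n‖ = ‖g n‖) (p : ℝ) :
    lpNormZ f p = lpNormZ g p :=
  eLpNorm_congr_norm_ae (Filter.Eventually.of_forall h)

lemma ConvBounded.modulate {K : ℤ → ℂ} {p : ℝ} (h : ConvBounded K p) (x : ℤ → ℂ)
    (hx : ∀ n, ‖x n‖ = 1) (hadd : ∀ m n, x (m + n) = x m * x n) :
    ConvBounded (fun n => x n * K n) p := by
  obtain ⟨C, hC⟩ := h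
  refine ⟨C, fun f hf => ?_⟩
  have hne : ∀ n, x n ≠ 0 := fun n h0 => by simpa [h0] using hx n
  have e : ∀ n, ‖convZ (fun n => x n * K n) f n‖ = ‖convZ K (fun j => (x j)⁻¹ * f j) n‖ := by
    intro n
    have : convZ (fun n => x n * K n) f n = x n * convZ K (fun j => (x j)⁻¹ * f j) n := by
      rw [convZ, convZ, ← tsum_mul_left]
      refine tsum_congr fun j => ?_
      have h2 : x n = x (n - j) * x j := by rw [← hadd]; congr 1; ring
      rw [h2]
      field_simp [hne j]
    rw [this, norm_mul, hx, one_mul]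
  have e2 : ∀ j, ‖(x j)⁻¹ * f j‖ = ‖f j‖ := fun j => by
    rw [norm_mul, norm_inv, hx, inv_one, one_mul]
  rw [lpNormZ_congr_norm e, ← lpNormZ_congr_norm e2]
  exact hC _ (by simpa only [e2] using hf)

lemma ConvBounded.add {K L : ℤ → ℂ} {p : ℝ} (hp : 1 ≤ p) {M N : ℝ} (hKM : ∀ n, ‖K n‖ ≤ M)
    (hLN : ∀ n, ‖L n‖ ≤ N) (hK : ConvBounded K p) (hL : ConvBounded L p) :
    ConvBounded (fun n => K n + L n) p := by
  obtain ⟨C, hC⟩ := hK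
  obtain ⟨D, hD⟩ := hL
  refine ⟨C + D, fun f hf => ?_⟩
  have e : convZ (fun n => K n + L n) f = convZ K f + convZ L f := by
    funext n
    simp only [convZ, Pi.add_apply]
    rw [← (summable_conv hKM hf n).tsum_add (summable_conv hLN hf n)]
    exact tsum_congr fun j => add_mul _ _ _
  rw [e]
  calc _ ≤ lpNormZ (convZ K f) p + lpNormZ (convZ L f) p :=
        eLpNorm_add_le (measurable_of_countable _).aestronglyMeasurable
          (measurable_of_countable _).aestronglyMeasurable (by simpa using hp)
    _ ≤ C * lpNormZ f p + D * lpNormZ f p := add_le_add (hC f hf) (hD f hf)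
    _ = _ := by push_cast; ring

lemma ConvBounded.sum {ι : Type*} (s : Finset ι) {K : ι → ℤ → ℂ} {p : ℝ} (hp : 1 ≤ p)
    (hbdd : ∀ i ∈ s, ∃ M, ∀ n, ‖K i n‖ ≤ M) (h : ∀ i ∈ s, ConvBounded (K i) p) :
    ConvBounded (fun n => ∑ i ∈ s, K i n) p := by
  classical
  induction s using Finset.induction_on with
  | empty =>
    refine ⟨0, fun f _ => ?_⟩
    have : convZ (fun n => ∑ i ∈ (∅ : Finset ι), K i n) f = 0 := by funext n; simp [convZ]
    rw [this]
    simp [lpNormZ]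
  | insert i s hi ih =>
    simp only [Finset.sum_insert hi]
    obtain ⟨M, hM⟩ := hbdd i (Finset.mem_insert_self _ _)
    choose! N hN using hbdd
    refine ConvBounded.add hp hM (N := ∑ j ∈ s, N j) (fun n => ?_) (h i (Finset.mem_insert_self _ _))
      (ih (fun j hj => ⟨N j, hN j (Finset.mem_insert_of_mem hj)⟩)
        fun j hj => h j (Finset.mem_insert_of_mem hj))
    exact (norm_sum_le _ _).trans
      (Finset.sum_le_sum fun j hj => hN j (Finset.mem_insert_of_mem hj) n)

lemma summable_norm_of_support_finite {f : ℤ → ℂ} (hf : f.support.Finite) :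
    Summable fun n => ‖f n‖ :=
  summable_of_ne_finset_zero (s := hf.toFinset) fun n hn => by simpa using hn

/-- Bounds on finitely supported functions extend to summable functions, for both the exponent and
its conjugate. -/
lemma convBounded_of_finite (K : ℤ → ℂ) (M : ℝ) (hK : ∀ n, ‖K n‖ ≤ M) (p q : ℝ)
    (hpq : p.HolderConjugate q) (C : NNReal)
    (hC : ∀ g : ℤ → ℂ, g.support.Finite → lpNormZ (convZ K g) p ≤ C * lpNormZ g p) :
    ConvBounded K p ∧ ConvBounded K q := by
  have h1 : ConvBounded (fun n => K (-n)) q :=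
    ⟨C, convZ_bound_of_dual _ M (fun n => hK _) p q hpq C (by simpa only [neg_neg] using hC)⟩
  constructor
  · obtain ⟨D, hD⟩ := h1
    exact ⟨D, convZ_bound_of_dual K M hK q p hpq.symm D fun g hg =>
      hD g (summable_norm_of_support_finite hg)⟩
  · simpa only [neg_neg] using h1.comp_neg hpq.symm.pos

/-- Calderón–Zygmund theorem for convolution operators on `ℤ`. -/
theorem convBounded_of_hormander (K : ℤ → ℂ) (M : ℝ) (hK : ∀ n, ‖K n‖ ≤ M) (A B : NNReal)
    (hL2 : ∀ f : ℤ → ℂ, f.support.Finite →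
      ∑' n, ‖convZ K f n‖ₑ ^ 2 ≤ A * ∑' n, ‖f n‖ₑ ^ 2)
    (hH : ∀ h : ℤ, ∑' n : ℤ, (if 2 * |h| ≤ |n| then ‖K (n - h) - K n‖ₑ else 0) ≤ B)
    (p : ℝ) (hp : 1 < p) : ConvBounded K p := by
  have lt2 : ∀ p : ℝ, 1 < p → p < 2 → ∃ C : NNReal, ∀ g : ℤ → ℂ, g.support.Finite →
      lpNormZ (convZ K g) p ≤ C * lpNormZ g p := by
    intro p hp1 hp2
    have hp0 : 0 < p := by linarith
    set W : NNReal := 4 + 24 * A + 4 * B with hW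
    set C : NNReal := Real.toNNReal p * (2 * W * Real.toNNReal (1 / (p - 1)) +
      4 * A * Real.toNNReal (1 / (2 - p))) with hC
    refine ⟨C ^ (1 / p), fun g hg => ?_⟩
    have := strong_type_of_weak_type K A W hL2 (fun f hf lam hlam => by
      have := weak_type_one K A B hL2 hH f hf lam hlam
      rw [hW]; push_cast; exact this) p hp1 hp2 g hg
    rw [lpNormZ_eq _ hp0, lpNormZ_eq _ hp0, ENNReal.coe_rpow_of_nonneg _ (by positivity),
      ← ENNReal.mul_rpow_of_nonneg _ _ (by positivity)]
    refine ENNReal.rpow_le_rpow (this.trans (le_of_eq ?_)) (by positivity)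
    rw [hC]
    push_cast
    rfl
  rcases lt_trichotomy p 2 with h | h | h
  · obtain ⟨C, hC⟩ := lt2 p hp h
    exact (convBounded_of_finite K M hK p _ (Real.HolderConjugate.conjExponent hp) C hC).1
  · subst h
    refine (convBounded_of_finite K M hK 2 2 Real.HolderConjugate.two_two (A ^ (1 / 2 : ℝ))
      fun g hg => ?_).1
    rw [lpNormZ_eq _ two_pos, lpNormZ_eq _ two_pos, ENNReal.coe_rpow_of_nonneg _ (by positivity),
      ← ENNReal.mul_rpow_of_nonneg _ _ (by positivity)]
    refine ENNReal.rpow_le_rpow ?_ (by positivity)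
    simpa only [ENNReal.rpow_two] using hL2 g hg
  · have hc := Real.HolderConjugate.conjExponent hp
    have h1 : Real.conjExponent p < 2 := by
      rw [Real.conjExponent, div_lt_iff₀ (by linarith)]; linarith
    obtain ⟨C, hC⟩ := lt2 _ hc.symm.lt h1
    exact (convBounded_of_finite K M hK _ p hc.symm C hC).2

/-- Fourier coefficients on `[0,1]`: the convolution kernel of the multiplier `m`. -/
noncomputable def multKernel (m : ℝ → ℂ) (n : ℤ) : ℂ :=
  ∫ ξ in (0 : ℝ)..1, m ξ * Complex.exp (-(2 * Real.pi * Complex.I) * (ξ : ℂ) * (n : ℂ))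

lemma norm_exp_two_pi (ξ : ℝ) (n : ℤ) :
    ‖Complex.exp (-(2 * Real.pi * Complex.I) * (ξ : ℂ) * (n : ℂ))‖ = 1 := by
  have : -(2 * Real.pi * Complex.I) * (ξ : ℂ) * (n : ℂ) =
      ((-(2 * Real.pi * ξ * n) : ℝ) : ℂ) * Complex.I := by push_cast; ring
  rw [this, Complex.norm_exp_ofReal_mul_I]

lemma multKernel_eq_fourierCoeffOn (m : ℝ → ℂ) (n : ℤ) :
    multKernel m n = fourierCoeffOn (zero_lt_one' ℝ) m n := by
  rw [fourierCoeffOn_eq_integral, multKernel]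
  simp only [sub_zero, div_one, one_smul]
  refine intervalIntegral.integral_congr fun ξ _ => ?_
  simp only [fourier_coe_apply, smul_eq_mul]
  rw [mul_comm]
  congr 2
  push_cast
  ring

lemma norm_multKernel_le (m : ℝ → ℂ) (M : ℝ) (hm : ∀ ξ ∈ Set.Ioo (0 : ℝ) 1, ‖m ξ‖ ≤ M) (n : ℤ) :
    ‖multKernel m n‖ ≤ M := by
  have := intervalIntegral.norm_integral_le_of_norm_le_const_ae (a := (0 : ℝ)) (b := 1) (C := M)
    (f := fun ξ => m ξ * Complex.exp (-(2 * Real.pi * Complex.I) * (ξ : ℂ) * (n : ℂ))) ?_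
  · rw [multKernel]
    simpa only [sub_zero, abs_one, mul_one] using this
  · filter_upwards [Measure.ae_ne volume (1 : ℝ)] with ξ hξ1 hξ
    rw [norm_mul, norm_exp_two_pi, mul_one]
    rw [Set.uIoc_of_le zero_le_one] at hξ
    exact hm ξ ⟨hξ.1, lt_of_le_of_ne hξ.2 hξ1⟩

lemma multKernel_one (n : ℤ) : multKernel (fun _ => 1) n = if n = 0 then 1 else 0 := by
  rw [multKernel]
  split_ifs with h
  · simp [h]
  · have hc : -(2 * Real.pi * Complex.I) * (n : ℂ) ≠ 0 := by
      simp [Real.pi_ne_zero, h]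
    have := integral_exp_mul_complex (a := 0) (b := 1) hc
    simp only [one_mul]
    rw [show (fun ξ : ℝ => Complex.exp (-(2 * Real.pi * Complex.I) * (ξ : ℂ) * (n : ℂ))) =
      fun ξ : ℝ => Complex.exp (-(2 * Real.pi * Complex.I) * (n : ℂ) * (ξ : ℂ)) by
        funext ξ; congr 1; ring, this]
    have e : Complex.exp (-(2 * Real.pi * Complex.I) * (n : ℂ)) = 1 := by
      rw [Complex.exp_eq_one_iff]
      exact ⟨-n, by push_cast; ring⟩
    rw [Complex.ofReal_one, Complex.ofReal_zero, mul_one, mul_zero, e, Complex.exp_zero, sub_self,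
      zero_div]

lemma intervalIntegrable_of_bounded {m : ℝ → ℂ} {a b M : ℝ} (hab : a ≤ b)
    (hmeas : AEStronglyMeasurable m (volume.restrict (Set.Ioo a b)))
    (hm : ∀ ξ ∈ Set.Ioo a b, ‖m ξ‖ ≤ M) : IntervalIntegrable m volume a b := by
  rw [intervalIntegrable_iff_integrableOn_Ioo_of_le hab]
  refine Integrable.of_bound hmeas M ?_
  filter_upwards [ae_restrict_mem measurableSet_Ioo] with ξ hξ using hm ξ hξ

/-- Convolving with the kernel of `m` multiplies the trigonometric polynomial by `m`. -/
lemma convZ_multKernel_of_finite (m : ℝ → ℂ) (hm : IntervalIntegrable m volume 0 1)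
    (f : ℤ → ℂ) (S : Finset ℤ) (hS : ∀ j ∉ S, f j = 0) (n : ℤ) :
    convZ (multKernel m) f n = multKernel (fun ξ => m ξ *
      ∑ j ∈ S, f j * Complex.exp (2 * Real.pi * Complex.I * (j : ℂ) * (ξ : ℂ))) n := by
  have hintg : ∀ j ∈ S, IntervalIntegrable (fun ξ : ℝ => m ξ *
      Complex.exp (-(2 * Real.pi * Complex.I) * (ξ : ℂ) * ((n - j : ℤ) : ℂ)) * f j) volume 0 1 :=
    fun j _ => (hm.mul_continuousOn (by fun_prop)).mul_const _
  rw [convZ_eq_sum _ f S hS]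
  simp only [multKernel, ← intervalIntegral.integral_mul_const]
  rw [← intervalIntegral.integral_finsetSum hintg]
  refine intervalIntegral.integral_congr fun ξ _ => ?_
  simp only [Finset.mul_sum, Finset.sum_mul]
  refine Finset.sum_congr rfl fun j _ => ?_
  rw [show -(2 * Real.pi * Complex.I) * (ξ : ℂ) * ((n - j : ℤ) : ℂ) =
    2 * Real.pi * Complex.I * (j : ℂ) * (ξ : ℂ) + -(2 * Real.pi * Complex.I) * (ξ : ℂ) * (n : ℂ) by
      push_cast; ring, Complex.exp_add]
  ring

lemma tsum_sq_convZ_multKernel_le (m : ℝ → ℂ) (M : ℝ)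
    (hmeas : AEStronglyMeasurable m (volume.restrict (Set.Ioo 0 1)))
    (hm : ∀ ξ ∈ Set.Ioo (0 : ℝ) 1, ‖m ξ‖ ≤ M) (f : ℤ → ℂ) (hf : f.support.Finite) :
    ∑' n, ‖convZ (multKernel m) f n‖ₑ ^ 2 ≤ ENNReal.ofReal (M ^ 2) * ∑' n, ‖f n‖ₑ ^ 2 := by
  have hS : ∀ j ∉ hf.toFinset, f j = 0 := fun j hj => by simpa using hj
  set F : ℝ → ℂ := fun ξ => ∑ j ∈ hf.toFinset,
    f j * Complex.exp (2 * Real.pi * Complex.I * (j : ℂ) * (ξ : ℂ)) with hF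
  have hFc : Continuous F := by fun_prop
  obtain ⟨D, hD⟩ := (isCompact_Icc (a := (0 : ℝ)) (b := 1)).exists_bound_of_continuousOn
    hFc.continuousOn
  have key : ∀ u : ℝ → ℂ, ∀ U : ℝ, AEStronglyMeasurable u (volume.restrict (Set.Ioo 0 1)) →
      (∀ ξ ∈ Set.Ioo (0 : ℝ) 1, ‖u ξ‖ ≤ U) →
      ∑' n, ‖convZ (multKernel u) f n‖ₑ ^ 2 =
        ENNReal.ofReal (∫ ξ in (0 : ℝ)..1, ‖u ξ * F ξ‖ ^ 2) := by
    intro u U hu hU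
    have hL2 : MemLp (fun ξ => u ξ * F ξ) 2 (volume.restrict (Set.Ioc 0 1)) := by
      rw [← restrict_Ioo_eq_restrict_Ioc]
      refine MemLp.of_bound (hu.mul hFc.aestronglyMeasurable) (U * D) ?_
      filter_upwards [ae_restrict_mem measurableSet_Ioo] with ξ hξ
      rw [norm_mul]
      have := hU ξ hξ
      have h2 := hD ξ (Set.Ioo_subset_Icc_self hξ)
      have := norm_nonneg (u ξ)
      have := norm_nonneg (F ξ)
      gcongr
      linarith
    have hs := hasSum_sq_fourierCoeffOn (zero_lt_one' ℝ) hL2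
    simp only [sub_zero, inv_one, one_smul] at hs
    rw [← hs.tsum_eq, ENNReal.ofReal_tsum_of_nonneg (fun _ => by positivity) hs.summable]
    refine tsum_congr fun n => ?_
    rw [convZ_multKernel_of_finite u (intervalIntegrable_of_bounded zero_le_one hu hU) f _ hS,
      multKernel_eq_fourierCoeffOn, ENNReal.ofReal_pow (norm_nonneg _), ofReal_norm]
  have h1 := key (fun _ => 1) 1 aestronglyMeasurable_const (by simp)
  have h1' : ∀ n, convZ (multKernel fun _ => 1) f n = f n := by
    intro n
    rw [convZ, tsum_eq_single n fun j hj => by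
      rw [multKernel_one, if_neg (sub_ne_zero.2 hj.symm), zero_mul]]
    simp [multKernel_one]
  simp only [h1', one_mul] at h1
  rw [key m M hmeas hm, h1, ← ENNReal.ofReal_mul (by positivity),
    ← intervalIntegral.integral_const_mul]
  refine ENNReal.ofReal_le_ofReal ?_
  have hFi : IntervalIntegrable (fun ξ => M ^ 2 * ‖F ξ‖ ^ 2) volume 0 1 :=
    Continuous.intervalIntegrable (by fun_prop) _ _
  rw [intervalIntegral.integral_of_le zero_le_one, intervalIntegral.integral_of_le zero_le_one]
  refine integral_mono_of_nonneg (Filter.Eventually.of_forall fun _ => by positivity) hFi.1 ?_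
  rw [Filter.EventuallyLE, ← restrict_Ioo_eq_restrict_Ioc]
  filter_upwards [ae_restrict_mem measurableSet_Ioo] with ξ hξ
  rw [norm_mul, mul_pow]
  have := hm ξ hξ
  gcongr

lemma norm_exp_mul_of_re_eq_zero {w : ℂ} (hw : w.re = 0) (x : ℝ) :
    ‖Complex.exp (w * (x : ℂ))‖ = 1 := by
  simp [Complex.norm_exp, hw]

/-- Two integrations by parts against an exponential. -/
lemma norm_integral_mul_exp_sub_le (F F1 F2 : ℝ → ℂ) {a b D : ℝ} (hab : a ≤ b) {w : ℂ}
    (hw : w ≠ 0) (hre : w.re = 0) (h1 : ∀ x ∈ Set.Icc a b, HasDerivAt F (F1 x) x)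
    (h2 : ∀ x ∈ Set.Icc a b, HasDerivAt F1 (F2 x) x) (hc : ContinuousOn F2 (Set.Icc a b))
    (g : ℝ → ℝ) (hg : IntervalIntegrable g volume a b) (hFg : ∀ x ∈ Set.Icc a b, ‖F2 x‖ ≤ g x)
    (hD : ∫ x in a..b, g x ≤ D) :
    ‖(∫ x in a..b, F x * Complex.exp (w * (x : ℂ))) -
      (F b * Complex.exp (w * (b : ℂ)) - F a * Complex.exp (w * (a : ℂ))) / w‖ ≤
      (‖F1 b‖ + ‖F1 a‖ + D) / ‖w‖ ^ 2 := by
  set e : ℝ → ℂ := fun x => Complex.exp (w * (x : ℂ)) with he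
  have he1 : ∀ x, ‖e x‖ = 1 := norm_exp_mul_of_re_eq_zero hre
  have hed : ∀ x : ℝ, HasDerivAt e (e x * w) x := fun x => by
    have := ((hasDerivAt_id (x : ℂ)).const_mul w).cexp.comp_ofReal
    simpa [he] using this
  have hec : Continuous e := by fun_prop
  have hFc : ContinuousOn F (Set.Icc a b) := fun x hx =>
    (h1 x hx).continuousAt.continuousWithinAt
  have hi1 : IntervalIntegrable (fun x => F x * e x) volume a b :=
    ContinuousOn.intervalIntegrable_of_Icc hab (hFc.mul hec.continuousOn)
  have hi2 : IntervalIntegrable (fun x => F2 x * e x / w ^ 2) volume a b :=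
    ContinuousOn.intervalIntegrable_of_Icc hab ((hc.mul hec.continuousOn).div_const _)
  have hftc := intervalIntegral.integral_eq_sub_of_hasDerivAt (a := a) (b := b)
    (f := fun x => F x * e x / w - F1 x * e x / w ^ 2)
    (f' := fun x => F x * e x - F2 x * e x / w ^ 2) (fun x hx => by
      rw [Set.uIcc_of_le hab] at hx
      have := (((h1 x hx).mul (hed x)).div_const w).sub
        (((h2 x hx).mul (hed x)).div_const (w ^ 2))
      refine this.congr_deriv ?_
      field_simp
      ring) (hi1.sub hi2)
  rw [intervalIntegral.integral_sub hi1 hi2, sub_eq_iff_eq_add] at hftc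
  have hrw : (∫ x in a..b, F x * e x) - (F b * e b - F a * e a) / w =
      -(F1 b * e b) / w ^ 2 + F1 a * e a / w ^ 2 + ∫ x in a..b, F2 x * e x / w ^ 2 := by
    rw [hftc]
    ring
  have hn2 : ‖∫ x in a..b, F2 x * e x / w ^ 2‖ ≤ D / ‖w‖ ^ 2 := by
    rw [intervalIntegral.integral_div, norm_div, norm_pow]
    gcongr
    refine le_trans ?_ hD
    refine intervalIntegral.norm_integral_le_of_norm_le hab ?_ hg
    filter_upwards with x hx
    rw [norm_mul, he1, mul_one]
    exact hFg x (Set.Ioc_subset_Icc_self hx)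
  rw [hrw]
  calc _ ≤ ‖-(F1 b * e b) / w ^ 2‖ + ‖F1 a * e a / w ^ 2‖ + D / ‖w‖ ^ 2 :=
        (norm_add₃_le).trans (by gcongr)
    _ = _ := by
        rw [norm_div, norm_div, norm_neg, norm_mul, norm_mul, he1, he1, norm_pow]
        ring

/-- A bounded function on `(0, ∞)` supported in `(0, 1)`, twice differentiable with derivatives
`m1`, `m2` which satisfy Mikhlin bounds at the origin. -/
structure IsMikhlin (C : ℝ) (m m1 m2 : ℝ → ℂ) : Prop where
  hasDerivAt : ∀ x, 0 < x → HasDerivAt m (m1 x) x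
  hasDerivAt' : ∀ x, 0 < x → HasDerivAt m1 (m2 x) x
  continuousOn : ContinuousOn m2 (Set.Ioi 0)
  norm_le : ∀ x, 0 < x → ‖m x‖ ≤ C
  norm_le' : ∀ x, 0 < x → ‖m1 x‖ ≤ C / x
  norm_le'' : ∀ x, 0 < x → ‖m2 x‖ ≤ C / x ^ 2
  eq_zero : ∀ x, 1 ≤ x → m x = 0

section

variable {C : ℝ} {m m1 m2 : ℝ → ℂ}

lemma IsMikhlin.nonneg (h : IsMikhlin C m m1 m2) : 0 ≤ C :=
  (norm_nonneg _).trans (h.norm_le 1 one_pos)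

lemma IsMikhlin.continuousOn_self (h : IsMikhlin C m m1 m2) : ContinuousOn m (Set.Ioi 0) :=
  fun x hx => (h.hasDerivAt x hx).continuousAt.continuousWithinAt

lemma IsMikhlin.continuousOn_deriv (h : IsMikhlin C m m1 m2) : ContinuousOn m1 (Set.Ioi 0) :=
  fun x hx => (h.hasDerivAt' x hx).continuousAt.continuousWithinAt

lemma IsMikhlin.aestronglyMeasurable (h : IsMikhlin C m m1 m2) (a : ℝ) (ha : 0 ≤ a) (b : ℝ) :
    AEStronglyMeasurable m (volume.restrict (Set.Ioo a b)) :=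
  (h.continuousOn_self.mono fun _ hx => ha.trans_lt hx.1).aestronglyMeasurable measurableSet_Ioo

lemma IsMikhlin.norm_integral_tail_le (h : IsMikhlin C m m1 m2) {H N : ℝ} (hH : 1 ≤ H)
    (hN : 0 < N) {w : ℂ} (hre : w.re = 0) (hw : N ≤ ‖w‖) :
    ‖(∫ x in H⁻¹..1, m x * Complex.exp (w * (x : ℂ))) +
      m H⁻¹ * Complex.exp (w * (H⁻¹ : ℝ)) / w‖ ≤ 3 * C * H / N ^ 2 := by
  have hH0 : 0 < H := by linarith
  have hHi : 0 < H⁻¹ := by positivity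
  have hH1 : H⁻¹ ≤ 1 := inv_le_one_of_one_le₀ hH
  have hC := h.nonneg
  have hpos : ∀ x ∈ Set.Icc H⁻¹ 1, 0 < x := fun x hx => hHi.trans_le hx.1
  have hw0 : w ≠ 0 := norm_pos_iff.1 (hN.trans_le hw)
  have hgc : ContinuousOn (fun x : ℝ => C / x ^ 2) (Set.Icc H⁻¹ 1) :=
    continuousOn_const.div (by fun_prop) fun x hx => (pow_pos (hpos x hx) 2).ne'
  have hgi : ∫ x in H⁻¹..1, C / x ^ 2 ≤ C * H := by
    have := intervalIntegral.integral_eq_sub_of_hasDerivAt (a := H⁻¹) (b := 1)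
      (f := fun x => -(C * x⁻¹)) (f' := fun x => C / x ^ 2) (fun x hx => by
        rw [Set.uIcc_of_le hH1] at hx
        have := ((hasDerivAt_inv (hpos x hx).ne').const_mul C).neg
        refine this.congr_deriv ?_
        field_simp) (ContinuousOn.intervalIntegrable_of_Icc hH1 hgc)
    rw [this]
    simp only [inv_inv, inv_one]
    linarith
  have := norm_integral_mul_exp_sub_le m m1 m2 hH1 hw0 hre
    (fun x hx => h.hasDerivAt x (hpos x hx)) (fun x hx => h.hasDerivAt' x (hpos x hx))
    (h.continuousOn.mono hpos) (fun x => C / x ^ 2)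
    (ContinuousOn.intervalIntegrable_of_Icc hH1 hgc) (fun x hx => h.norm_le'' x (hpos x hx)) hgi
  rw [h.eq_zero 1 le_rfl, zero_mul, zero_sub, neg_div, sub_neg_eq_add] at this
  refine this.trans ?_
  have a1 := h.norm_le' 1 one_pos
  have a2 := h.norm_le' _ hHi
  rw [div_one] at a1
  rw [div_inv_eq_mul] at a2
  have : C ≤ C * H := le_mul_of_one_le_right hC hH
  gcongr
  linarith

lemma norm_exp_mul_sub_one_le {v : ℂ} (hv : v.re = 0) {x : ℝ} (hx : 0 ≤ x) :
    ‖Complex.exp (v * (x : ℂ)) - 1‖ ≤ ‖v‖ * x := by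
  have e : v * (x : ℂ) = Complex.I * ((v.im * x : ℝ) : ℂ) := by
    apply Complex.ext <;> simp [hv]
  have := Real.norm_exp_I_mul_ofReal_sub_one_le (x := v.im * x)
  rw [e]
  refine this.trans ?_
  rw [norm_mul, Real.norm_eq_abs, Real.norm_of_nonneg hx]
  gcongr
  exact Complex.abs_im_le_norm v

lemma IsMikhlin.norm_integral_middle_le (h : IsMikhlin C m m1 m2) {H N : ℝ} (hH : 1 ≤ H)
    (hHN : H ≤ N) {v w : ℂ} (hvre : v.re = 0) (hv : ‖v‖ ≤ 7 * H) (hre : w.re = 0) (hw : N ≤ ‖w‖) :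
    ‖(∫ x in N⁻¹..H⁻¹, m x * (Complex.exp (v * (x : ℂ)) - 1) * Complex.exp (w * (x : ℂ))) -
      m H⁻¹ * (Complex.exp (v * (H⁻¹ : ℝ)) - 1) * Complex.exp (w * (H⁻¹ : ℝ)) / w‖ ≤
      (35 + 70 * Real.log (N / H)) * (C * H) / N ^ 2 := by
  have hH0 : 0 < H := by linarith
  have hN0 : 0 < N := by linarith
  have hab : N⁻¹ ≤ H⁻¹ := inv_anti₀ hH0 hHN
  have hC := h.nonneg
  have hNi : 0 < N⁻¹ := by positivity
  have hpos : ∀ x ∈ Set.Icc N⁻¹ H⁻¹, 0 < x := fun x hx => hNi.trans_le hx.1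
  have hw0 : w ≠ 0 := norm_pos_iff.1 (hN0.trans_le hw)
  set e : ℝ → ℂ := fun x => Complex.exp (v * (x : ℂ)) with he
  have he1 : ∀ x, ‖e x‖ = 1 := norm_exp_mul_of_re_eq_zero hvre
  have hed : ∀ x : ℝ, HasDerivAt e (v * e x) x := fun x => by
    have := ((hasDerivAt_id (x : ℂ)).const_mul v).cexp.comp_ofReal
    simpa [he, mul_comm] using this
  have hec : Continuous e := by fun_prop
  have hs : ∀ x, 0 < x → ‖e x - 1‖ ≤ 7 * H * x := fun x hx =>
    (norm_exp_mul_sub_one_le hvre hx.le).trans (by gcongr)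
  have hg0 : ∀ x, 0 < x → ‖m x * (e x - 1)‖ ≤ C * (7 * H * x) := fun x hx => by
    rw [norm_mul]
    exact mul_le_mul (h.norm_le x hx) (hs x hx) (norm_nonneg _) hC
  have hg1 : ∀ x, 0 < x → ‖m1 x * (e x - 1) + m x * (v * e x)‖ ≤ 14 * (C * H) := fun x hx => by
    calc _ ≤ ‖m1 x‖ * ‖e x - 1‖ + ‖m x‖ * (‖v‖ * ‖e x‖) := by
          refine (norm_add_le _ _).trans ?_
          rw [norm_mul, norm_mul, norm_mul]
      _ ≤ C / x * (7 * H * x) + C * (7 * H * 1) := by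
          have := h.norm_le x hx
          have := h.norm_le' x hx
          have := hs x hx
          rw [he1]
          gcongr
      _ = _ := by field_simp; ring
  have hg2 : ∀ x ∈ Set.Icc N⁻¹ H⁻¹,
      ‖m2 x * (e x - 1) + 2 * v * m1 x * e x + v ^ 2 * m x * e x‖ ≤ 70 * (C * H) * x⁻¹ := by
    intro x hx
    have hx0 := hpos x hx
    have hHx : H ≤ x⁻¹ := (le_inv_comm₀ hH0 hx0).2 hx.2
    calc _ ≤ ‖m2 x‖ * ‖e x - 1‖ + 2 * ‖v‖ * ‖m1 x‖ * ‖e x‖ + ‖v‖ ^ 2 * ‖m x‖ * ‖e x‖ := by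
          refine norm_add₃_le.trans ?_
          simp only [norm_mul, norm_pow, Complex.norm_ofNat]
          exact le_rfl
      _ ≤ C / x ^ 2 * (7 * H * x) + 2 * (7 * H) * (C / x) * 1 + (7 * H) ^ 2 * C * 1 := by
          have := h.norm_le x hx0
          have := h.norm_le' x hx0
          have := h.norm_le'' x hx0
          have := hs x hx0
          rw [he1]
          gcongr
      _ = 21 * (C * H) * x⁻¹ + 49 * (C * H) * H := by field_simp; ring
      _ ≤ 21 * (C * H) * x⁻¹ + 49 * (C * H) * x⁻¹ := by gcongr
      _ = _ := by ring
  have hinvi : IntervalIntegrable (fun x : ℝ => 70 * (C * H) * x⁻¹) volume N⁻¹ H⁻¹ :=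
    ContinuousOn.intervalIntegrable_of_Icc hab
      (continuousOn_const.mul (continuousOn_inv₀.mono fun x hx => (hpos x hx).ne'))
  have hintg : ∫ x in N⁻¹..H⁻¹, 70 * (C * H) * x⁻¹ ≤ 70 * (C * H) * Real.log (N / H) := by
    rw [intervalIntegral.integral_const_mul, integral_inv_of_pos hNi (by positivity)]
    refine le_of_eq ?_
    congr 2
    field_simp
  have hd1 : ∀ x ∈ Set.Icc N⁻¹ H⁻¹, HasDerivAt (fun x => m x * (e x - 1))
      (m1 x * (e x - 1) + m x * (v * e x)) x := fun x hx =>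
    (h.hasDerivAt x (hpos x hx)).mul ((hed x).sub_const 1)
  have hd2 : ∀ x ∈ Set.Icc N⁻¹ H⁻¹, HasDerivAt (fun x => m1 x * (e x - 1) + m x * (v * e x))
      (m2 x * (e x - 1) + 2 * v * m1 x * e x + v ^ 2 * m x * e x) x := fun x hx => by
    have := ((h.hasDerivAt' x (hpos x hx)).mul ((hed x).sub_const 1)).add
      ((h.hasDerivAt x (hpos x hx)).mul ((hed x).const_mul v))
    refine this.congr_deriv ?_
    ring
  have hmc := h.continuousOn_self.mono hpos
  have hm1c := h.continuousOn_deriv.mono hpos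
  have hm2c := h.continuousOn.mono hpos
  have hc : ContinuousOn (fun x => m2 x * (e x - 1) + 2 * v * m1 x * e x + v ^ 2 * m x * e x)
      (Set.Icc N⁻¹ H⁻¹) := by fun_prop
  have key := norm_integral_mul_exp_sub_le _ _ _ hab hw0 hre hd1 hd2 hc _ hinvi hg2 hintg
  have b1 := hg1 _ hNi
  have b2 := hg1 H⁻¹ (by positivity)
  have b0 : ‖m N⁻¹ * (e N⁻¹ - 1) * Complex.exp (w * (N⁻¹ : ℝ)) / w‖ ≤ 7 * (C * H) / N ^ 2 := by
    rw [norm_div, norm_mul, norm_exp_mul_of_re_eq_zero hre, mul_one]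
    calc _ ≤ C * (7 * H * N⁻¹) / N := by
          gcongr
          exact hg0 _ hNi
      _ = _ := by field_simp
  rw [sub_div] at key
  rw [← sub_add] at key
  have t := norm_sub_le_of_le key b0
  rw [add_sub_cancel_right] at t
  refine t.trans ?_
  calc _ ≤ (14 * (C * H) + 14 * (C * H) + 70 * (C * H) * Real.log (N / H)) / N ^ 2 +
        7 * (C * H) / N ^ 2 := by
        have : 0 ≤ Real.log (N / H) := Real.log_nonneg ((one_le_div hH0).2 hHN)
        gcongr
    _ = _ := by ring

lemma IsMikhlin.norm_integral_le (h : IsMikhlin C m m1 m2) {H N : ℝ} (hH : 1 ≤ H)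
    (hHN : H ≤ N) {v w : ℂ} (hvre : v.re = 0) (hv : ‖v‖ ≤ 7 * H) (hre : w.re = 0) (hw : N ≤ ‖w‖)
    (hw' : N ≤ ‖w + v‖) :
    ‖∫ x in (0 : ℝ)..1, m x * (Complex.exp (v * (x : ℂ)) - 1) * Complex.exp (w * (x : ℂ))‖ ≤
      (55 + 70 * Real.log (N / H)) * (C * H) / N ^ 2 := by
  have hH0 : 0 < H := by linarith
  have hN0 : 0 < N := by linarith
  have hab : N⁻¹ ≤ H⁻¹ := inv_anti₀ hH0 hHN
  have hH1 : H⁻¹ ≤ 1 := inv_le_one_of_one_le₀ hH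
  have hC := h.nonneg
  have hNi : 0 < N⁻¹ := by positivity
  have hHi : 0 < H⁻¹ := by positivity
  have hw0 : w ≠ 0 := norm_pos_iff.1 (hN0.trans_le hw)
  have hw0' : w + v ≠ 0 := norm_pos_iff.1 (hN0.trans_le hw')
  have hre' : (w + v).re = 0 := by simp [hre, hvre]
  have hmi : ∀ a b : ℝ, 0 ≤ a → a ≤ b → IntervalIntegrable m volume a b := fun a b ha hb =>
    intervalIntegrable_of_bounded hb (h.aestronglyMeasurable a ha b)
      fun x hx => h.norm_le x (ha.trans_lt hx.1)
  have hgi : ∀ a b : ℝ, 0 ≤ a → a ≤ b → IntervalIntegrable (fun x =>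
      m x * (Complex.exp (v * (x : ℂ)) - 1) * Complex.exp (w * (x : ℂ))) volume a b :=
    fun a b ha hb => ((hmi a b ha hb).mul_continuousOn (by fun_prop)).mul_continuousOn
      (by fun_prop)
  rw [← intervalIntegral.integral_add_adjacent_intervals (hgi 0 N⁻¹ le_rfl hNi.le)
    (hgi N⁻¹ 1 hNi.le (hab.trans hH1)), ← intervalIntegral.integral_add_adjacent_intervals
    (hgi N⁻¹ H⁻¹ hNi.le hab) (hgi H⁻¹ 1 hHi.le hH1)]
  have e1 : ∫ x in H⁻¹..1, m x * (Complex.exp (v * (x : ℂ)) - 1) * Complex.exp (w * (x : ℂ)) =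
      (∫ x in H⁻¹..1, m x * Complex.exp ((w + v) * (x : ℂ))) -
        ∫ x in H⁻¹..1, m x * Complex.exp (w * (x : ℂ)) := by
    rw [← intervalIntegral.integral_sub
      ((hmi _ _ hHi.le hH1).mul_continuousOn (by fun_prop))
      ((hmi _ _ hHi.le hH1).mul_continuousOn (by fun_prop))]
    refine intervalIntegral.integral_congr fun x _ => ?_
    simp only [add_mul, Complex.exp_add]
    ring
  have b1 : ‖∫ x in (0 : ℝ)..N⁻¹,
      m x * (Complex.exp (v * (x : ℂ)) - 1) * Complex.exp (w * (x : ℂ))‖ ≤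
        7 * (C * H) / N ^ 2 := by
    refine (intervalIntegral.norm_integral_le_of_norm_le_const
      (C := C * (7 * H * N⁻¹)) fun x hx => ?_).trans (le_of_eq ?_)
    · rw [Set.uIoc_of_le hNi.le] at hx
      rw [norm_mul, norm_exp_mul_of_re_eq_zero hre, mul_one, norm_mul]
      have := h.norm_le x hx.1
      have := norm_exp_mul_sub_one_le hvre hx.1.le
      have hx2 := hx.2
      have := hx.1.le
      calc _ ≤ C * (‖v‖ * x) := by gcongr
        _ ≤ _ := by gcongr
    · rw [sub_zero, abs_of_pos hNi]
      field_simp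
  have b2 := h.norm_integral_middle_le hH hHN hvre hv hre hw
  have b3 := h.norm_integral_tail_le hH hN0 hre hw
  have b4 := h.norm_integral_tail_le hH hN0 hre' hw'
  have b5 : ‖m H⁻¹ * Complex.exp ((w + v) * (H⁻¹ : ℝ)) * (w⁻¹ - (w + v)⁻¹)‖ ≤
      7 * (C * H) / N ^ 2 := by
    rw [inv_sub_inv hw0 hw0', add_sub_cancel_left, norm_mul, norm_mul, norm_div, norm_mul,
      norm_exp_mul_of_re_eq_zero hre', mul_one]
    have := h.norm_le _ hHi
    calc _ ≤ C * (7 * H / (N * N)) := by gcongr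
      _ = _ := by ring
  rw [e1]
  set I1 := ∫ x in (0 : ℝ)..N⁻¹,
      m x * (Complex.exp (v * (x : ℂ)) - 1) * Complex.exp (w * (x : ℂ))
  set I2 := ∫ x in N⁻¹..H⁻¹, m x * (Complex.exp (v * (x : ℂ)) - 1) * Complex.exp (w * (x : ℂ))
  set I3 := ∫ x in H⁻¹..1, m x * Complex.exp (w * (x : ℂ))
  set I4 := ∫ x in H⁻¹..1, m x * Complex.exp ((w + v) * (x : ℂ))
  have e2 : I1 + (I2 + (I4 - I3)) = I1 + (I2 -
      m H⁻¹ * (Complex.exp (v * (H⁻¹ : ℝ)) - 1) * Complex.exp (w * (H⁻¹ : ℝ)) / w) -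
      (I3 + m H⁻¹ * Complex.exp (w * (H⁻¹ : ℝ)) / w) +
      (I4 + m H⁻¹ * Complex.exp ((w + v) * (H⁻¹ : ℝ)) / (w + v)) +
      m H⁻¹ * Complex.exp ((w + v) * (H⁻¹ : ℝ)) * (w⁻¹ - (w + v)⁻¹) := by
    rw [add_mul w v, Complex.exp_add]
    ring
  rw [e2]
  refine (norm_add_le_of_le (norm_add_le_of_le (norm_sub_le_of_le (norm_add_le_of_le b1 b2) b3)
    b4) b5).trans (le_of_eq ?_)
  ring

lemma tsum_ite_le_of_telescoping (g Φ : ℕ → ENNReal) (D : ℕ)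
    (h : ∀ n, D ≤ n → g n + Φ (n + 1) ≤ Φ n) :
    ∑' n, (if D ≤ n then g n else 0) ≤ Φ D := by
  refine ENNReal.tsum_le_of_sum_range_le fun N => ?_
  suffices H : ∑ n ∈ Finset.range N, (if D ≤ n then g n else 0) + Φ (max N D) ≤ Φ D from
    le_self_add.trans H
  induction N with
  | zero => simp
  | succ N ih =>
    rw [Finset.sum_range_succ]
    by_cases hN : D ≤ N
    · rw [if_pos hN, add_assoc, max_eq_left (by omega)]
      rw [max_eq_left hN] at ih
      exact (add_le_add le_rfl (h N hN)).trans ih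
    · rw [if_neg hN, add_zero, max_eq_right (by omega)]
      rwa [max_eq_right (by omega)] at ih

lemma sqrt_div_mul_le_telescoping {H n : ℝ} (hH : 0 < H) (hn : 1 < n) :
    √(n / H) * H / n ^ 2 ≤ 2 * √H / √(n - 1) - 2 * √H / √n := by
  have hz : 0 < √H := Real.sqrt_pos.2 hH
  have hx : 0 < √n := Real.sqrt_pos.2 (by linarith)
  have hy : 0 < √(n - 1) := Real.sqrt_pos.2 (by linarith)
  have hz2 : √H ^ 2 = H := Real.sq_sqrt hH.le
  have hx2 : √n ^ 2 = n := Real.sq_sqrt (by linarith)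
  have hy2 : √(n - 1) ^ 2 = n - 1 := Real.sq_sqrt (by linarith)
  rw [Real.sqrt_div (by linarith)]
  have e1 : √n / √H * H / n ^ 2 = √H / √n ^ 3 := by
    nth_rewrite 2 [← hz2]
    nth_rewrite 2 [← hx2]
    field_simp
  rw [e1]
  set x := √n
  set y := √(n - 1)
  set z := √H
  have hyx : y ≤ x := Real.sqrt_le_sqrt (by linarith)
  have hfac : (x - y) * (x + y) = 1 := by nlinarith
  have key : y ≤ 2 * x ^ 2 * (x - y) := by
    have : y * (x + y) ≤ 2 * x ^ 2 * (x - y) * (x + y) := by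
      rw [mul_assoc, hfac]
      nlinarith
    exact le_of_mul_le_mul_right this (by positivity)
  have e2 : 2 * z / y - 2 * z / x - z / x ^ 3 = z * (2 * x ^ 2 * (x - y) - y) / (x ^ 3 * y) := by
    field_simp
  have : 0 ≤ z * (2 * x ^ 2 * (x - y) - y) / (x ^ 3 * y) := by
    apply div_nonneg
    · exact mul_nonneg hz.le (by linarith)
    · positivity
  linarith

lemma IsMikhlin.norm_multKernel_sub_le (hm : IsMikhlin C m m1 m2) {h n : ℤ} (hh : h ≠ 0)
    (hn : 2 * |h| ≤ |n|) :
    ‖multKernel m (n - h) - multKernel m n‖ ≤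
      195 * C * (√((n.natAbs : ℝ) / h.natAbs) * h.natAbs / (n.natAbs : ℝ) ^ 2) := by
  have hC := hm.nonneg
  set H : ℝ := (h.natAbs : ℝ) with hHdef
  set N : ℝ := (n.natAbs : ℝ) with hNdef
  have hH : 1 ≤ H := by
    have : 1 ≤ h.natAbs := Int.natAbs_pos.2 hh
    rw [hHdef]
    exact_mod_cast this
  have hHN : 2 * H ≤ N := by
    have : 2 * h.natAbs ≤ n.natAbs := by
      rw [Int.abs_eq_natAbs, Int.abs_eq_natAbs] at hn
      omega
    rw [hHdef, hNdef]
    exact_mod_cast this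
  have hHabs : |(h : ℝ)| = H := by rw [hHdef, Nat.cast_natAbs, Int.cast_abs]
  have hNabs : |(n : ℝ)| = N := by rw [hNdef, Nat.cast_natAbs, Int.cast_abs]
  set w : ℂ := ((-(2 * π * n) : ℝ) : ℂ) * Complex.I with hw
  set v : ℂ := ((2 * π * h : ℝ) : ℂ) * Complex.I with hv
  have hpi := Real.pi_gt_three
  have hpi2 := Real.pi_lt_d2
  have hwn : N ≤ ‖w‖ := by
    rw [hw, norm_mul, Complex.norm_I, mul_one, Complex.norm_real, Real.norm_eq_abs, abs_neg,
      abs_mul, abs_of_pos (by positivity : 0 < 2 * π), hNabs]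
    nlinarith
  have hvn : ‖v‖ ≤ 7 * H := by
    rw [hv, norm_mul, Complex.norm_I, mul_one, Complex.norm_real, Real.norm_eq_abs,
      abs_mul, abs_of_pos (by positivity : 0 < 2 * π), hHabs]
    nlinarith
  have hwvn : N ≤ ‖w + v‖ := by
    rw [hw, hv, ← add_mul, ← Complex.ofReal_add, norm_mul, Complex.norm_I, mul_one,
      Complex.norm_real, Real.norm_eq_abs,
      show -(2 * π * n) + 2 * π * h = -(2 * π * ((n : ℝ) - h)) by ring, abs_neg, abs_mul,
      abs_of_pos (by positivity : 0 < 2 * π)]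
    have := abs_sub_abs_le_abs_sub (n : ℝ) h
    rw [hHabs, hNabs] at this
    nlinarith
  have hmi : IntervalIntegrable m volume 0 1 :=
    intervalIntegrable_of_bounded zero_le_one (hm.aestronglyMeasurable 0 le_rfl 1)
      fun x hx => hm.norm_le x hx.1
  have key := hm.norm_integral_le hH (by linarith) (v := v) (w := w) (by simp [hv]) hvn
    (by simp [hw]) hwn hwvn
  have e : multKernel m (n - h) - multKernel m n =
      ∫ x in (0 : ℝ)..1, m x * (Complex.exp (v * (x : ℂ)) - 1) * Complex.exp (w * (x : ℂ)) := by
    rw [multKernel, multKernel, ← intervalIntegral.integral_sub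
      (hmi.mul_continuousOn (by fun_prop)) (hmi.mul_continuousOn (by fun_prop))]
    refine intervalIntegral.integral_congr fun x _ => ?_
    have e1 : -(2 * π * Complex.I) * (x : ℂ) * ((n - h : ℤ) : ℂ) = v * x + w * x := by
      rw [hv, hw]
      push_cast
      ring
    have e2 : -(2 * π * Complex.I) * (x : ℂ) * (n : ℂ) = w * x := by
      rw [hw]
      push_cast
      ring
    simp only [e1, e2, Complex.exp_add]
    ring
  rw [e]
  refine key.trans ?_
  have hr : 1 ≤ √(N / H) := by
    rw [Real.one_le_sqrt, one_le_div (by linarith)]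
    linarith
  have hlog : Real.log (N / H) ≤ 2 * √(N / H) := by
    have h0 : 0 < N / H := div_pos (by linarith) (by linarith)
    have := Real.log_le_sub_one_of_pos (Real.sqrt_pos.2 h0)
    rw [Real.log_sqrt h0.le] at this
    linarith
  calc _ ≤ (55 * √(N / H) + 70 * (2 * √(N / H))) * (C * H) / N ^ 2 := by
        gcongr
        linarith
    _ = _ := by ring

lemma IsMikhlin.tsum_multKernel_sub_le (hm : IsMikhlin C m m1 m2) (h : ℤ) :
    ∑' n : ℤ, (if 2 * |h| ≤ |n| then ‖multKernel m (n - h) - multKernel m n‖ₑ else 0) ≤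
      ENNReal.ofReal (780 * C) := by
  have hC := hm.nonneg
  rcases eq_or_ne h 0 with rfl | hh
  · simp
  have hH1 : 1 ≤ h.natAbs := Int.natAbs_pos.2 hh
  set H : ℝ := (h.natAbs : ℝ) with hHdef
  have hH : 1 ≤ H := by
    rw [hHdef]
    exact_mod_cast hH1
  have hH0 : 0 < H := by linarith
  set g : ℕ → ENNReal := fun n =>
    ENNReal.ofReal (195 * C * (√((n : ℝ) / H) * H / (n : ℝ) ^ 2)) with hg
  set Φ : ℕ → ENNReal := fun n => ENNReal.ofReal (195 * C * (2 * √H / √((n : ℝ) - 1))) with hΦ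
  have hterm : ∀ n : ℤ, (if 2 * |h| ≤ |n| then ‖multKernel m (n - h) - multKernel m n‖ₑ else 0) ≤
      if 2 * h.natAbs ≤ n.natAbs then g n.natAbs else 0 := by
    intro n
    by_cases hn : 2 * |h| ≤ |n|
    · rw [if_pos hn, if_pos (by rw [Int.abs_eq_natAbs, Int.abs_eq_natAbs] at hn; omega),
        ← ofReal_norm]
      exact ENNReal.ofReal_le_ofReal (hm.norm_multKernel_sub_le hh hn)
    · rw [if_neg hn]
      exact zero_le
  have htel : ∑' n, (if 2 * h.natAbs ≤ n then g n else 0) ≤ Φ (2 * h.natAbs) := by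
    refine tsum_ite_le_of_telescoping g Φ _ fun n hn => ?_
    have hn2 : (2 : ℝ) ≤ n := by exact_mod_cast (by omega : 2 ≤ n)
    rw [hg, hΦ]
    simp only [Nat.cast_add, Nat.cast_one, add_sub_cancel_right]
    rw [← ENNReal.ofReal_add (by positivity) (by positivity)]
    apply ENNReal.ofReal_le_ofReal
    rw [← mul_add]
    have := sqrt_div_mul_le_telescoping hH0 (by linarith : (1 : ℝ) < n)
    gcongr
    linarith
  have hend : Φ (2 * h.natAbs) ≤ ENNReal.ofReal (390 * C) := by
    apply ENNReal.ofReal_le_ofReal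
    push_cast
    rw [← hHdef]
    have h1 : √H ≤ √(2 * H - 1) := Real.sqrt_le_sqrt (by linarith)
    have h2 : 0 < √(2 * H - 1) := Real.sqrt_pos.2 (by linarith)
    have h3 : 2 * √H / √(2 * H - 1) ≤ 2 := by
      rw [div_le_iff₀ h2]
      linarith
    calc _ ≤ 195 * C * 2 := by gcongr
      _ = _ := by ring
  refine (ENNReal.tsum_le_tsum hterm).trans ?_
  rw [tsum_of_nat_of_neg_add_one ENNReal.summable ENNReal.summable,
    show 780 * C = 390 * C + 390 * C by ring, ENNReal.ofReal_add (by positivity) (by positivity)]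
  refine add_le_add ?_ ?_
  · simpa using htel.trans hend
  · refine le_trans ?_ (htel.trans hend)
    have := ENNReal.tsum_comp_le_tsum_of_injective (add_left_injective (1 : ℕ))
      (fun n => if 2 * h.natAbs ≤ n then g n else 0)
    refine le_trans (le_of_eq (tsum_congr fun n => ?_)) this
    have : (-((n : ℤ) + 1)).natAbs = n + 1 := by omega
    rw [this]

/-- The kernel of a compactly supported Mikhlin multiplier on the half-line is bounded
on `ℓ^p`. -/
lemma IsMikhlin.convBounded (hm : IsMikhlin C m m1 m2) (p : ℝ) (hp : 1 < p) :
    ConvBounded (multKernel m) p := by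
  have hb : ∀ ξ ∈ Set.Ioo (0 : ℝ) 1, ‖m ξ‖ ≤ C := fun ξ hξ => hm.norm_le ξ hξ.1
  exact convBounded_of_hormander (multKernel m) C (norm_multKernel_le m C hb)
    (Real.toNNReal (C ^ 2)) (Real.toNNReal (780 * C))
    (fun f hf => tsum_sq_convZ_multKernel_le m C (hm.aestronglyMeasurable 0 le_rfl 1) hb f hf)
    hm.tsum_multKernel_sub_le p hp

end

lemma hasDerivAt_indicator_Iio {F F1 : ℝ → ℂ} {L r : ℝ} (hr : r < L)
    (hF : ∀ x ∈ Set.Ioo 0 L, HasDerivAt F (F1 x) x) (h0 : ∀ x, r < x → F x = 0) (x : ℝ)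
    (hx : 0 < x) :
    HasDerivAt ((Set.Iio L).indicator F) ((Set.Iio L).indicator F1 x) x := by
  rcases lt_or_ge x L with hxL | hxL
  · rw [Set.indicator_of_mem (Set.mem_Iio.2 hxL) F1]
    refine (hF x ⟨hx, hxL⟩).congr_of_eventuallyEq ?_
    filter_upwards [Iio_mem_nhds hxL] with y hy using Set.indicator_of_mem hy _
  · rw [Set.indicator_of_notMem (by simpa using hxL)]
    refine (hasDerivAt_const x (0 : ℂ)).congr_of_eventuallyEq ?_
    filter_upwards [Ioi_mem_nhds (hr.trans_le hxL)] with y hy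
    rw [Set.indicator_apply]
    split_ifs
    exacts [h0 y hy, rfl]

lemma continuousOn_indicator_Iio {F : ℝ → ℂ} {L r : ℝ} (hr : r < L)
    (hF : ContinuousOn F (Set.Ioo 0 L)) (h0 : ∀ x, r < x → F x = 0) :
    ContinuousOn ((Set.Iio L).indicator F) (Set.Ioi 0) := by
  intro x hx
  apply ContinuousAt.continuousWithinAt
  rcases lt_or_ge x L with hxL | hxL
  · refine (hF.continuousAt (Ioo_mem_nhds hx hxL)).congr ?_
    filter_upwards [Iio_mem_nhds hxL] with y hy using (Set.indicator_of_mem hy _).symm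
  · refine (continuousAt_const (y := (0 : ℂ))).congr ?_
    filter_upwards [Ioi_mem_nhds (hr.trans_le hxL)] with y hy
    rw [Set.indicator_apply]
    split_ifs
    exacts [(h0 y hy).symm, rfl]

/-- `μ` is twice differentiable on `(0, L)`, with derivatives `μ1`, `μ2` which satisfy Mikhlin
bounds at both endpoints. -/
structure IsMikhlinOn (L C : ℝ) (μ μ1 μ2 : ℝ → ℂ) : Prop where
  hasDerivAt : ∀ x ∈ Set.Ioo 0 L, HasDerivAt μ (μ1 x) x
  hasDerivAt' : ∀ x ∈ Set.Ioo 0 L, HasDerivAt μ1 (μ2 x) x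
  continuousOn : ContinuousOn μ2 (Set.Ioo 0 L)
  norm_le : ∀ x ∈ Set.Ioo 0 L, ‖μ x‖ ≤ C
  norm_le' : ∀ x ∈ Set.Ioo 0 L, (x * (L - x)) * ‖μ1 x‖ ≤ C
  norm_le'' : ∀ x ∈ Set.Ioo 0 L, (x * (L - x)) ^ 2 * ‖μ2 x‖ ≤ C

section

variable {L C : ℝ} {μ μ1 μ2 : ℝ → ℂ}

lemma IsMikhlinOn.reflect (h : IsMikhlinOn L C μ μ1 μ2) :
    IsMikhlinOn L C (fun x => μ (L - x)) (fun x => -μ1 (L - x)) (fun x => μ2 (L - x)) := by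
  have hmem : ∀ x ∈ Set.Ioo 0 L, L - x ∈ Set.Ioo 0 L := fun x hx =>
    ⟨by linarith [hx.2], by linarith [hx.1]⟩
  have hd : ∀ x : ℝ, HasDerivAt (fun x => L - x) (-1) x := fun x => (hasDerivAt_id x).const_sub L
  have e : ∀ x : ℝ, (L - x) * (L - (L - x)) = x * (L - x) := fun x => by ring
  refine ⟨fun x hx => ?_, fun x hx => ?_, ?_, fun x hx => h.norm_le _ (hmem x hx),
    fun x hx => ?_, fun x hx => ?_⟩
  · exact ((h.hasDerivAt _ (hmem x hx)).scomp x (hd x)).congr_deriv (by simp)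
  · exact ((h.hasDerivAt' _ (hmem x hx)).scomp x (hd x)).neg.congr_deriv (by simp)
  · exact h.continuousOn.comp (by fun_prop) hmem
  · rw [norm_neg, ← e]
    exact h.norm_le' _ (hmem x hx)
  · rw [← e]
    exact h.norm_le'' _ (hmem x hx)

lemma IsMikhlinOn.intervalIntegrable (h : IsMikhlinOn L C μ μ1 μ2) (hL : 0 < L) :
    IntervalIntegrable μ volume 0 L := by
  refine intervalIntegrable_of_bounded hL.le ?_ h.norm_le
  exact ContinuousOn.aestronglyMeasurable
    (fun x hx => (h.hasDerivAt x hx).continuousAt.continuousWithinAt) measurableSet_Ioo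

lemma IsMikhlinOn.exists_isMikhlin_indicator (h : IsMikhlinOn L C μ μ1 μ2) (hL : 0 < L)
    (hL1 : L ≤ 1) {ψ : ℝ → ℂ} (hψ : ContDiff ℝ 2 ψ) (h0 : ∀ x, 2 / 3 * L < x → ψ x = 0) :
    ∃ C' n1 n2, IsMikhlin C' ((Set.Iio L).indicator fun x => μ x * ψ x) n1 n2 := by
  have hr : 2 / 3 * L < L := by linarith
  have hψd : Differentiable ℝ ψ := hψ.differentiable (by norm_num)
  have hψ1 : ContDiff ℝ 1 (deriv ψ) := by
    have : ContDiff ℝ (1 + 1) ψ := by simpa [one_add_one_eq_two] using hψ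
    exact (contDiff_succ_iff_deriv.1 this).2.2
  have hψ1d : Differentiable ℝ (deriv ψ) := hψ1.differentiable (by norm_num)
  have hψ2 : Continuous (deriv (deriv ψ)) := hψ1.continuous_deriv le_rfl
  have h10 : ∀ x, 2 / 3 * L < x → deriv ψ x = 0 := fun x hx => by
    have : ψ =ᶠ[nhds x] fun _ => 0 := by
      filter_upwards [Ioi_mem_nhds hx] with y hy using h0 y hy
    rw [this.deriv_eq, deriv_const]
  have h20 : ∀ x, 2 / 3 * L < x → deriv (deriv ψ) x = 0 := fun x hx => by
    have : deriv ψ =ᶠ[nhds x] fun _ => 0 := by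
      filter_upwards [Ioi_mem_nhds hx] with y hy using h10 y hy
    rw [this.deriv_eq, deriv_const]
  obtain ⟨B0, hB0⟩ := (isCompact_Icc (a := (0 : ℝ)) (b := L)).exists_bound_of_continuousOn
    hψ.continuous.continuousOn
  obtain ⟨B1, hB1⟩ := (isCompact_Icc (a := (0 : ℝ)) (b := L)).exists_bound_of_continuousOn
    hψ1.continuous.continuousOn
  obtain ⟨B2, hB2⟩ := (isCompact_Icc (a := (0 : ℝ)) (b := L)).exists_bound_of_continuousOn
    hψ2.continuousOn
  set B := max B0 (max B1 B2) with hB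
  have hC : 0 ≤ C := (norm_nonneg _).trans (h.norm_le (L / 2) ⟨by linarith, by linarith⟩)
  have hBn : 0 ≤ B := ((norm_nonneg _).trans (hB0 0 ⟨le_rfl, hL.le⟩)).trans (le_max_left _ _)
  set A := 3 / L with hA
  have hA0 : 0 < A := by positivity
  have hmuc : ContinuousOn μ (Set.Ioo 0 L) :=
    fun x hx => (h.hasDerivAt x hx).continuousAt.continuousWithinAt
  have hmu1c : ContinuousOn μ1 (Set.Ioo 0 L) :=
    fun x hx => (h.hasDerivAt' x hx).continuousAt.continuousWithinAt
  have hmu2c := h.continuousOn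
  have hloc : ∀ x ∈ Set.Ioc 0 (2 / 3 * L), ‖μ x‖ ≤ C ∧ ‖μ1 x‖ ≤ A * C / x ∧
      ‖μ2 x‖ ≤ A ^ 2 * C / x ^ 2 ∧ ‖ψ x‖ ≤ B ∧ ‖deriv ψ x‖ ≤ B ∧ ‖deriv (deriv ψ) x‖ ≤ B := by
    intro x hx
    have hxI : x ∈ Set.Ioo 0 L := ⟨hx.1, hx.2.trans_lt hr⟩
    have hxc : x ∈ Set.Icc 0 L := Set.Ioo_subset_Icc_self hxI
    have hx0 := hx.1
    have hxL : 1 ≤ A * (L - x) := by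
      rw [hA, div_mul_eq_mul_div, one_le_div hL]
      linarith [hx.2]
    have hLx : 0 < L - x := by linarith [hxI.2]
    refine ⟨h.norm_le x hxI, ?_, ?_, (hB0 x hxc).trans (le_max_left _ _),
      (hB1 x hxc).trans ((le_max_left _ _).trans (le_max_right _ _)),
      (hB2 x hxc).trans ((le_max_right _ _).trans (le_max_right _ _))⟩
    · rw [le_div_iff₀ hx0]
      have h1 := h.norm_le' x hxI
      calc ‖μ1 x‖ * x ≤ ‖μ1 x‖ * x * (A * (L - x)) := le_mul_of_one_le_right (by positivity) hxL
        _ = A * ((x * (L - x)) * ‖μ1 x‖) := by ring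
        _ ≤ _ := by gcongr
    · rw [le_div_iff₀ (by positivity)]
      have h1 := h.norm_le'' x hxI
      calc ‖μ2 x‖ * x ^ 2 ≤ ‖μ2 x‖ * x ^ 2 * (A * (L - x)) ^ 2 :=
            le_mul_of_one_le_right (by positivity) (one_le_pow₀ hxL)
        _ = A ^ 2 * ((x * (L - x)) ^ 2 * ‖μ2 x‖) := by ring
        _ ≤ _ := by gcongr
  set G1 : ℝ → ℂ := fun x => μ1 x * ψ x + μ x * deriv ψ x with hG1
  set G2 : ℝ → ℂ := fun x => μ2 x * ψ x + 2 * μ1 x * deriv ψ x + μ x * deriv (deriv ψ) x with hG2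
  have hG10 : ∀ x, 2 / 3 * L < x → G1 x = 0 := fun x hx => by simp [hG1, h0 x hx, h10 x hx]
  have hG20 : ∀ x, 2 / 3 * L < x → G2 x = 0 := fun x hx => by
    simp [hG2, h0 x hx, h10 x hx, h20 x hx]
  have hind : ∀ (F : ℝ → ℂ) (b : ℝ → ℝ), (∀ x, 2 / 3 * L < x → F x = 0) →
      (∀ x, 0 < x → 0 ≤ b x) → (∀ x ∈ Set.Ioc 0 (2 / 3 * L), ‖F x‖ ≤ b x) →
      ∀ x, 0 < x → ‖(Set.Iio L).indicator F x‖ ≤ b x := by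
    intro F b hF hb hFb x hx
    refine (norm_indicator_le_norm_self _ _).trans ?_
    rcases le_or_gt x (2 / 3 * L) with hx2 | hx2
    · exact hFb x ⟨hx, hx2⟩
    · rw [hF x hx2, norm_zero]
      exact hb x hx
  have hCB : 0 ≤ C * B := by positivity
  refine ⟨(A + 1) ^ 2 * (C * B), (Set.Iio L).indicator G1, (Set.Iio L).indicator G2,
    hasDerivAt_indicator_Iio hr (fun x hx =>
      (h.hasDerivAt x hx).mul (hψd x).hasDerivAt) (fun x hx => by simp [h0 x hx]),
    hasDerivAt_indicator_Iio hr (fun x hx => ?_) hG10,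
    continuousOn_indicator_Iio hr ?_ hG20,
    hind _ (fun _ => (A + 1) ^ 2 * (C * B)) (fun x hx => by simp [h0 x hx])
      (fun x hx => by positivity) fun x hx => ?_,
    hind _ (fun x => (A + 1) ^ 2 * (C * B) / x) hG10 (fun x hx => by positivity) fun x hx => ?_,
    hind _ (fun x => (A + 1) ^ 2 * (C * B) / x ^ 2) hG20 (fun x hx => by positivity)
      fun x hx => ?_, fun x hx => ?_⟩
  · refine (((h.hasDerivAt' x hx).mul (hψd x).hasDerivAt).add
      ((h.hasDerivAt x hx).mul (hψ1d x).hasDerivAt)).congr_deriv ?_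
    simp only [hG2]
    ring
  · have := hψ.continuous
    have := hψ1.continuous
    fun_prop
  · obtain ⟨b0, b1, b2, c0, c1, c2⟩ := hloc x hx
    calc ‖μ x * ψ x‖ ≤ C * B := by
          rw [norm_mul]
          gcongr
      _ ≤ _ := le_mul_of_one_le_left hCB (one_le_pow₀ (by linarith))
  · obtain ⟨b0, b1, b2, c0, c1, c2⟩ := hloc x hx
    have hx0 := hx.1
    have hx1 : x ≤ 1 := by linarith [hx.2]
    calc ‖G1 x‖ ≤ ‖μ1 x‖ * ‖ψ x‖ + ‖μ x‖ * ‖deriv ψ x‖ := by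
          refine (norm_add_le _ _).trans ?_
          rw [norm_mul, norm_mul]
      _ ≤ A * C / x * B + C * B := by gcongr
      _ = (A + x) * (C * B) / x := by field_simp
      _ ≤ _ := by
          gcongr
          nlinarith
  · obtain ⟨b0, b1, b2, c0, c1, c2⟩ := hloc x hx
    have hx0 := hx.1
    have hx1 : x ≤ 1 := by linarith [hx.2]
    calc ‖G2 x‖ ≤ ‖μ2 x‖ * ‖ψ x‖ + 2 * ‖μ1 x‖ * ‖deriv ψ x‖ + ‖μ x‖ * ‖deriv (deriv ψ) x‖ := by
          refine norm_add₃_le.trans ?_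
          simp only [norm_mul, Complex.norm_ofNat]
          exact le_rfl
      _ ≤ A ^ 2 * C / x ^ 2 * B + 2 * (A * C / x) * B + C * B := by gcongr
      _ = (A + x) ^ 2 * (C * B) / x ^ 2 := by
          field_simp
          ring
      _ ≤ _ := by gcongr
  · rw [Set.indicator_of_notMem]
    simp only [Set.mem_Iio, not_lt]
    linarith

lemma IsMikhlinOn.convBounded_of_cutoff (h : IsMikhlinOn L C μ μ1 μ2) (hL : 0 < L)
    (hL1 : L ≤ 1) {ψ : ℝ → ℂ} (hψ : ContDiff ℝ 2 ψ) (h0 : ∀ x, 2 / 3 * L < x → ψ x = 0)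
    {p : ℝ} (hp : 1 < p) :
    ConvBounded (fun n => ∫ x in (0 : ℝ)..L,
      μ x * ψ x * Complex.exp (-(2 * π * Complex.I) * (x : ℂ) * (n : ℂ))) p := by
  obtain ⟨C', n1, n2, hm⟩ := h.exists_isMikhlin_indicator hL hL1 hψ h0
  convert hm.convBounded p hp using 1
  funext n
  have hi : IntervalIntegrable (fun x : ℝ => (Set.Iio L).indicator (fun x => μ x * ψ x) x *
      Complex.exp (-(2 * π * Complex.I) * (x : ℂ) * (n : ℂ))) volume 0 1 :=
    (intervalIntegrable_of_bounded zero_le_one (hm.aestronglyMeasurable 0 le_rfl 1)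
      fun x hx => hm.norm_le x hx.1).mul_continuousOn (by fun_prop)
  rw [multKernel, ← intervalIntegral.integral_add_adjacent_intervals (b := L)
    (hi.mono_set (by rw [Set.uIcc_of_le hL.le, Set.uIcc_of_le zero_le_one]; gcongr))
    (hi.mono_set (by rw [Set.uIcc_of_le hL1, Set.uIcc_of_le zero_le_one]; gcongr))]
  have e1 : ∫ x in L..1, (Set.Iio L).indicator (fun x => μ x * ψ x) x *
      Complex.exp (-(2 * π * Complex.I) * (x : ℂ) * (n : ℂ)) = 0 := by
    rw [intervalIntegral.integral_congr (g := fun _ => 0), intervalIntegral.integral_zero]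
    intro x hx
    rw [Set.uIcc_of_le hL1] at hx
    simp only [Set.indicator_of_notMem (Set.notMem_Iio.2 hx.1), zero_mul]
  rw [e1, add_zero]
  refine intervalIntegral.integral_congr_ae ?_
  filter_upwards [Measure.ae_ne volume L] with x hxL hx
  rw [Set.uIoc_of_le hL.le] at hx
  rw [Set.indicator_of_mem (Set.mem_Iio.2 (lt_of_le_of_ne hx.2 hxL))]

lemma norm_integral_mul_exp_le {a b : ℝ} (hab : a ≤ b) (g : ℝ → ℂ) (n : ℤ) :
    ‖∫ x in a..b, g x * Complex.exp (-(2 * π * Complex.I) * (x : ℂ) * (n : ℂ))‖ ≤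
      ∫ x in a..b, ‖g x‖ := by
  refine (intervalIntegral.norm_integral_le_integral_norm hab).trans (le_of_eq ?_)
  simp only [norm_mul, norm_exp_two_pi, mul_one]

/-- Multiplier kernels localized to an interval are bounded on `ℓ^p` under Mikhlin bounds at the
endpoints. -/
lemma IsMikhlinOn.convBounded (h : IsMikhlinOn L C μ μ1 μ2) (hL : 0 < L)
    (hL1 : L ≤ 1) {p : ℝ} (hp : 1 < p) :
    ConvBounded (fun n => ∫ x in (0 : ℝ)..L,
      μ x * Complex.exp (-(2 * π * Complex.I) * (x : ℂ) * (n : ℂ))) p := by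
  set T : ℝ → ℂ := fun x => ((Real.smoothTransition (3 * (x / L) - 1) : ℝ) : ℂ) with hT
  have hTs : ContDiff ℝ 2 T := by
    refine Complex.ofRealCLM.contDiff.comp (Real.smoothTransition.contDiff.comp ?_)
    fun_prop
  have hT1 : ∀ x, 2 / 3 * L < x → T x = 1 := fun x hx => by
    have : 2 / 3 < x / L := (lt_div_iff₀ hL).2 hx
    simp [hT, Real.smoothTransition.one_of_one_le (x := 3 * (x / L) - 1) (by linarith)]
  have hT0 : ∀ x, 2 / 3 * L < x → T (L - x) = 0 := fun x hx => by
    have : 2 / 3 < x / L := (lt_div_iff₀ hL).2 hx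
    have e : 3 * ((L - x) / L) - 1 = 2 - 3 * (x / L) := by field_simp; ring
    simp [hT, e, Real.smoothTransition.zero_of_nonpos (x := 2 - 3 * (x / L)) (by linarith)]
  have hleft := h.convBounded_of_cutoff hL hL1 (ψ := fun x => 1 - T x) (by fun_prop)
    (fun x hx => by rw [hT1 x hx, sub_self]) hp
  have hright := h.reflect.convBounded_of_cutoff hL hL1 (ψ := fun x => T (L - x))
    (hTs.comp (by fun_prop)) hT0 hp
  have hmod := (hright.comp_neg (by linarith)).modulate
    (fun n : ℤ => Complex.exp (-(2 * π * Complex.I) * (L : ℂ) * (n : ℂ)))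
    (norm_exp_two_pi L) (fun a b => by
      rw [← Complex.exp_add]
      push_cast
      ring_nf)
  convert ConvBounded.add hp.le (fun n => norm_integral_mul_exp_le hL.le _ n) (fun n => by
    rw [norm_mul, norm_exp_two_pi, one_mul]
    exact norm_integral_mul_exp_le hL.le _ (-n)) hleft hmod using 1
  funext n
  have hTc : Continuous T := hTs.continuous
  have hmu := h.intervalIntegrable hL
  have e1 : ∫ x in (0 : ℝ)..L, μ x * T x *
      Complex.exp (-(2 * π * Complex.I) * (x : ℂ) * (n : ℂ)) =
      Complex.exp (-(2 * π * Complex.I) * (L : ℂ) * (n : ℂ)) *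
        ∫ x in (0 : ℝ)..L, μ (L - x) * T (L - x) *
          Complex.exp (-(2 * π * Complex.I) * (x : ℂ) * ((-n : ℤ) : ℂ)) := by
    have := intervalIntegral.integral_comp_sub_left (a := 0) (b := L) (fun x : ℝ =>
      μ x * T x * Complex.exp (-(2 * π * Complex.I) * (x : ℂ) * (n : ℂ))) L
    rw [sub_self, sub_zero] at this
    rw [← this, ← intervalIntegral.integral_const_mul]
    refine intervalIntegral.integral_congr fun x _ => ?_
    have e2 : -(2 * π * Complex.I) * ((L - x : ℝ) : ℂ) * (n : ℂ) =
        -(2 * π * Complex.I) * (L : ℂ) * (n : ℂ) +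
          -(2 * π * Complex.I) * (x : ℂ) * ((-n : ℤ) : ℂ) := by
      push_cast
      ring
    simp only [e2, Complex.exp_add]
    ring
  rw [← e1, ← intervalIntegral.integral_add
    ((hmu.mul_continuousOn (by fun_prop)).mul_continuousOn (by fun_prop))
    ((hmu.mul_continuousOn (by fun_prop)).mul_continuousOn (by fun_prop))]
  refine intervalIntegral.integral_congr fun x _ => ?_
  ring

end

lemma TmultZ_eq_convZ (m : ℝ → ℂ) (hm : IntervalIntegrable m volume 0 1) (f : ℤ → ℂ)
    (hf : Summable fun n => ‖f n‖) : TmultZ m f = convZ (multKernel m) f := by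
  funext n
  have hmi : IntegrableOn m (Set.Ioo 0 1) :=
    (intervalIntegrable_iff_integrableOn_Ioo_of_le zero_le_one).1 hm
  set F : ℤ → ℝ → ℂ := fun j ξ =>
    m ξ * Complex.exp (-(2 * π * Complex.I) * (ξ : ℂ) * ((n - j : ℤ) : ℂ)) * f j with hF
  have hFn : ∀ j ξ, ‖F j ξ‖ = ‖m ξ‖ * ‖f j‖ := fun j ξ => by
    rw [hF, norm_mul, norm_mul, norm_exp_two_pi, mul_one]
  have hFi : ∀ j, Integrable (F j) (volume.restrict (Set.Ioo 0 1)) := fun j => by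
    refine (Integrable.mono' hmi.norm ?_ ?_).mul_const (f j)
    · exact hmi.aestronglyMeasurable.mul (by fun_prop)
    · filter_upwards with ξ
      rw [norm_mul, norm_exp_two_pi, mul_one]
  have hFs : Summable fun j => ∫ ξ in Set.Ioo (0 : ℝ) 1, ‖F j ξ‖ := by
    simp only [hFn, integral_mul_const]
    exact hf.mul_left _
  rw [TmultZ, convZ]
  calc _ = ∫ ξ in Set.Ioo (0 : ℝ) 1, ∑' j, F j ξ := by
        refine integral_congr_ae (Filter.Eventually.of_forall fun ξ => ?_)
        simp only [dftZ]
        rw [← tsum_mul_left, ← tsum_mul_right]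
        refine tsum_congr fun j => ?_
        have e : -(2 * π * Complex.I) * (ξ : ℂ) * ((n - j : ℤ) : ℂ) =
            2 * π * Complex.I * (j : ℂ) * (ξ : ℂ) +
              -(2 * π * Complex.I) * (ξ : ℂ) * (n : ℂ) := by
          push_cast
          ring
        simp only [hF, e, Complex.exp_add]
        ring
    _ = ∑' j, ∫ ξ in Set.Ioo (0 : ℝ) 1, F j ξ :=
        (hasSum_integral_of_summable_integral_norm hFi hFs).tsum_eq.symm
    _ = _ := by
        refine tsum_congr fun j => ?_
        rw [multKernel, intervalIntegral.integral_of_le zero_le_one,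
          integral_Ioc_eq_integral_Ioo, ← integral_mul_const]

lemma exists_pos_mul_le_prod_abs_sub {s : ℕ} {a : Fin (s + 1) → ℝ} (ha : StrictMono a)
    (i : Fin s) : ∃ κ : ℝ, 0 < κ ∧ ∀ ξ ∈ Set.Ioo (a i.castSucc) (a i.succ),
      κ * ((ξ - a i.castSucc) * (a i.succ - ξ)) ≤ ∏ j, |ξ - a j| := by
  classical
  have hne : i.succ ≠ i.castSucc := i.castSucc_lt_succ.ne'
  set S : Finset (Fin (s + 1)) := (Finset.univ.erase i.castSucc).erase i.succ with hS
  refine ⟨∏ j ∈ S, min |a j - a i.castSucc| |a j - a i.succ|, ?_, fun ξ hξ => ?_⟩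
  · refine Finset.prod_pos fun j hj => ?_
    rw [hS, Finset.mem_erase, Finset.mem_erase] at hj
    exact lt_min (abs_pos.2 (sub_ne_zero.2 (ha.injective.ne hj.2.1)))
      (abs_pos.2 (sub_ne_zero.2 (ha.injective.ne hj.1)))
  · have h1 : |ξ - a i.castSucc| = ξ - a i.castSucc := abs_of_pos (sub_pos.2 hξ.1)
    have h2 : |ξ - a i.succ| = a i.succ - ξ := by
      rw [abs_sub_comm]
      exact abs_of_pos (sub_pos.2 hξ.2)
    have h3 : 0 < (ξ - a i.castSucc) * (a i.succ - ξ) :=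
      mul_pos (sub_pos.2 hξ.1) (sub_pos.2 hξ.2)
    rw [← Finset.mul_prod_erase Finset.univ _ (Finset.mem_univ i.castSucc),
      ← Finset.mul_prod_erase (Finset.univ.erase i.castSucc) _
        (Finset.mem_erase.2 ⟨hne, Finset.mem_univ _⟩), h1, h2,
      ← mul_assoc (ξ - a i.castSucc), mul_comm _ ((ξ - a i.castSucc) * (a i.succ - ξ))]
    refine mul_le_mul_of_nonneg_left (Finset.prod_le_prod
      (fun j _ => le_min (abs_nonneg _) (abs_nonneg _)) fun j hj => ?_) h3.le
    rw [hS, Finset.mem_erase, Finset.mem_erase] at hj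
    rcases lt_or_ge j i.castSucc with hji | hji
    · refine (min_le_left _ _).trans ?_
      have := ha hji
      rw [abs_sub_comm, abs_of_pos (by linarith), abs_of_pos (by linarith [hξ.1])]
      linarith [hξ.1]
    · refine (min_le_right _ _).trans ?_
      have hji' : i.castSucc < j := lt_of_le_of_ne hji (Ne.symm hj.2.1)
      have : i.succ < j := lt_of_le_of_ne (Fin.castSucc_lt_iff_succ_le.1 hji') (Ne.symm hj.1)
      have := ha this
      rw [abs_sub_comm ξ, abs_of_pos (by linarith), abs_of_pos (by linarith [hξ.2])]
      linarith [hξ.2]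

lemma multKernel_eq_sum {s : ℕ} {a : Fin (s + 1) → ℝ} (ha : StrictMono a) (h0 : a 0 = 0)
    (h1 : a (Fin.last s) = 1) {m : ℝ → ℂ} (hm : IntervalIntegrable m volume 0 1) (n : ℤ) :
    multKernel m n = ∑ i : Fin s,
      Complex.exp (-(2 * π * Complex.I) * (a i.castSucc : ℂ) * (n : ℂ)) *
        ∫ x in (0 : ℝ)..(a i.succ - a i.castSucc), m (a i.castSucc + x) *
          Complex.exp (-(2 * π * Complex.I) * (x : ℂ) * (n : ℂ)) := by
  set b : ℕ → ℝ := fun k => if h : k < s + 1 then a ⟨k, h⟩ else 1 with hb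
  have hbi : ∀ k (h : k < s + 1), b k = a ⟨k, h⟩ := fun k h => by rw [hb]; exact dif_pos h
  have ha01 : ∀ j, a j ∈ Set.Icc (0 : ℝ) 1 := fun j => by
    rw [← h0, ← h1]
    exact ⟨ha.monotone (Fin.zero_le _), ha.monotone (Fin.le_last _)⟩
  have hi : IntervalIntegrable (fun ξ : ℝ => m ξ *
      Complex.exp (-(2 * π * Complex.I) * (ξ : ℂ) * (n : ℂ))) volume 0 1 :=
    hm.mul_continuousOn (by fun_prop)
  have hsum := intervalIntegral.sum_integral_adjacent_intervals (n := s) (a := b)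
    (μ := volume) (f := fun ξ : ℝ => m ξ *
      Complex.exp (-(2 * π * Complex.I) * (ξ : ℂ) * (n : ℂ))) fun k hk => by
        refine hi.mono_set ?_
        rw [hbi k (by omega), hbi (k + 1) (by omega), Set.uIcc_of_le (zero_le_one' ℝ)]
        exact Set.uIcc_subset_Icc (ha01 _) (ha01 _)
  rw [hbi 0 (by omega), hbi s (by omega), Fin.mk_zero, h0,
    show (⟨s, Nat.lt_succ_self s⟩ : Fin (s + 1)) = Fin.last s from rfl, h1] at hsum
  rw [multKernel, ← hsum, Finset.sum_range]
  refine Finset.sum_congr rfl fun i _ => ?_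
  have hc : b i = a i.castSucc := hbi i (by omega)
  have hs : b (i + 1) = a i.succ := hbi (i + 1) (by omega)
  have := intervalIntegral.integral_comp_add_left (a := 0) (b := a i.succ - a i.castSucc)
    (fun ξ : ℝ => m ξ * Complex.exp (-(2 * π * Complex.I) * (ξ : ℂ) * (n : ℂ))) (a i.castSucc)
  rw [add_zero, add_sub_cancel] at this
  rw [hc, hs, ← this, ← intervalIntegral.integral_const_mul]
  refine intervalIntegral.integral_congr fun x _ => ?_
  have e : -(2 * π * Complex.I) * ((a i.castSucc + x : ℝ) : ℂ) * (n : ℂ) =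
      -(2 * π * Complex.I) * (a i.castSucc : ℂ) * (n : ℂ) +
        -(2 * π * Complex.I) * (x : ℂ) * (n : ℂ) := by
    push_cast
    ring
  simp only [e, Complex.exp_add]
  ring

/-- The Mikhlin condition relative to a subdivision localizes to each of its intervals. -/
lemma exists_isMikhlinOn {s : ℕ} {a : Fin (s + 1) → ℝ} (ha : StrictMono a) (h0 : a 0 = 0)
    (h1 : a (Fin.last s) = 1) {m : ℝ → ℂ} (hsmooth : ContDiffOn ℝ 2 m (Set.Ioo (0 : ℝ) 1)) {c : ℝ}
    (hmik : ∀ k : ℕ, k ≤ 2 → ∀ ξ ∈ Set.Ioo (0 : ℝ) 1,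
      (∏ j, |ξ - a j| ^ k) * ‖iteratedDerivWithin k m (Set.Ioo (0 : ℝ) 1) ξ‖ ≤ c) (i : Fin s) :
    ∃ C, IsMikhlinOn (a i.succ - a i.castSucc) C (fun x => m (a i.castSucc + x))
      (fun x => deriv m (a i.castSucc + x)) (fun x => deriv (deriv m) (a i.castSucc + x)) := by
  obtain ⟨κ, hκ, hκP⟩ := exists_pos_mul_le_prod_abs_sub ha i
  have hmem : ∀ x ∈ Set.Ioo 0 (a i.succ - a i.castSucc),
      a i.castSucc + x ∈ Set.Ioo (a i.castSucc) (a i.succ) := fun x hx =>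
    ⟨by linarith [hx.1], by linarith [hx.2]⟩
  have hsub : Set.Ioo (a i.castSucc) (a i.succ) ⊆ Set.Ioo (0 : ℝ) 1 := by
    rw [← h0, ← h1]
    exact Set.Ioo_subset_Ioo (ha.monotone (Fin.zero_le _)) (ha.monotone (Fin.le_last _))
  have hmem' := fun x hx => hsub (hmem x hx)
  have hs2 : ContDiffOn ℝ (1 + 1) m (Set.Ioo (0 : ℝ) 1) := by
    simpa [one_add_one_eq_two] using hsmooth
  obtain ⟨hd, -, hs1⟩ := (contDiffOn_succ_iff_deriv_of_isOpen isOpen_Ioo).1 hs2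
  have hs1' : ContDiffOn ℝ (0 + 1) (deriv m) (Set.Ioo (0 : ℝ) 1) := by simpa using hs1
  obtain ⟨hd1, -, hs0⟩ := (contDiffOn_succ_iff_deriv_of_isOpen isOpen_Ioo).1 hs1'
  have hP : ∀ k ≤ 2, ∀ x ∈ Set.Ioo 0 (a i.succ - a i.castSucc),
      (x * (a i.succ - a i.castSucc - x)) ^ k * ‖iteratedDeriv k m (a i.castSucc + x)‖ ≤
        c / κ ^ k := by
    intro k hk x hx
    have h1 := hmik k hk _ (hmem' x hx)
    rw [iteratedDerivWithin_of_isOpen isOpen_Ioo (hmem' x hx), Finset.prod_pow] at h1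
    have h2 := hκP _ (hmem x hx)
    rw [add_sub_cancel_left, ← sub_sub] at h2
    have hx0 : 0 < x * (a i.succ - a i.castSucc - x) := mul_pos hx.1 (by linarith [hx.2])
    rw [le_div_iff₀ (by positivity)]
    calc _ = (κ * (x * (a i.succ - a i.castSucc - x))) ^ k *
          ‖iteratedDeriv k m (a i.castSucc + x)‖ := by
          rw [mul_pow κ]
          ring
      _ ≤ (∏ j, |a i.castSucc + x - a j|) ^ k * ‖iteratedDeriv k m (a i.castSucc + x)‖ := by
          gcongr
      _ ≤ c := h1
  refine ⟨max (c / κ ^ 0) (max (c / κ ^ 1) (c / κ ^ 2)), fun x hx => ?_, fun x hx => ?_, ?_,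
    fun x hx => ?_, fun x hx => ?_, fun x hx => ?_⟩
  · exact ((hd.differentiableAt (isOpen_Ioo.mem_nhds (hmem' x hx))).hasDerivAt).comp_const_add _ _
  · exact ((hd1.differentiableAt (isOpen_Ioo.mem_nhds (hmem' x hx))).hasDerivAt).comp_const_add _ _
  · exact hs0.continuousOn.comp (by fun_prop) hmem'
  · have := hP 0 (by norm_num) x hx
    rw [pow_zero, one_mul, iteratedDeriv_zero] at this
    exact this.trans (le_max_left _ _)
  · have := hP 1 (by norm_num) x hx
    rw [pow_one, iteratedDeriv_one] at this
    exact this.trans ((le_max_left _ _).trans (le_max_right _ _))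
  · have := hP 2 le_rfl x hx
    rw [iteratedDeriv_succ, iteratedDeriv_one] at this
    exact this.trans ((le_max_right _ _).trans (le_max_right _ _))

/-- If `0 = a_0 < a_1 < ⋯ < a_s = 1` is a subdivision of `[0,1]` and `m` is a bounded
`C²` function on `(0,1)` with `(∏_j |ξ − a_j|^k)|m^{(k)}(ξ)| ≤ c` for `k = 0,1,2`,
then `T_m` is bounded on `ℓ^p(ℤ)` for all `1 < p < ∞`. -/
theorem stmt_16 (s : ℕ) (a : Fin (s + 1) → ℝ) (hmono : StrictMono a)
    (h0 : a 0 = 0) (h1 : a (Fin.last s) = 1)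
    (m : ℝ → ℂ) (M : ℝ) (hbdd : ∀ ξ ∈ Set.Ioo (0 : ℝ) 1, ‖m ξ‖ ≤ M)
    (hsmooth : ContDiffOn ℝ 2 m (Set.Ioo (0 : ℝ) 1))
    (c : ℝ) (hc : 0 < c)
    (hmik : ∀ k : ℕ, k ≤ 2 → ∀ ξ ∈ Set.Ioo (0 : ℝ) 1,
      (∏ j, |ξ - a j| ^ k) * ‖iteratedDerivWithin k m (Set.Ioo (0 : ℝ) 1) ξ‖ ≤ c) :
    ∀ p : ℝ, 1 < p →
      ∃ C : ℝ, 0 < C ∧ ∀ f : ℤ → ℂ, Summable (fun n => ‖f n‖) →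
        lpNormZ (TmultZ m f) p ≤ ENNReal.ofReal C * lpNormZ f p := by
  intro p hp
  have hmi : IntervalIntegrable m volume 0 1 := intervalIntegrable_of_bounded zero_le_one
    (hsmooth.continuousOn.aestronglyMeasurable measurableSet_Ioo) hbdd
  have ha01 : ∀ j, a j ∈ Set.Icc (0 : ℝ) 1 := fun j => by
    rw [← h0, ← h1]
    exact ⟨hmono.monotone (Fin.zero_le _), hmono.monotone (Fin.le_last _)⟩
  have hgap : ∀ i : Fin s, 0 < a i.succ - a i.castSucc := fun i =>
    sub_pos.2 (hmono i.castSucc_lt_succ)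
  have hK : ConvBounded (multKernel m) p := by
    rw [funext fun n => multKernel_eq_sum hmono h0 h1 hmi n]
    refine ConvBounded.sum _ hp.le (fun i _ =>
      ⟨∫ x in (0 : ℝ)..(a i.succ - a i.castSucc), ‖m (a i.castSucc + x)‖, fun n => ?_⟩) fun i _ => ?_
    · rw [norm_mul, norm_exp_two_pi, one_mul]
      exact norm_integral_mul_exp_le (hgap i).le _ n
    · obtain ⟨C, hC⟩ := exists_isMikhlinOn hmono h0 h1 hsmooth hmik i
      refine (hC.convBounded (hgap i) (by linarith [(ha01 i.succ).2, (ha01 i.castSucc).1])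
        hp).modulate _ (norm_exp_two_pi _) fun k l => ?_
      rw [← Complex.exp_add]
      push_cast
      ring_nf
  obtain ⟨C, hC⟩ := hK
  refine ⟨C + 1, by positivity, fun f hf => ?_⟩
  rw [TmultZ_eq_convZ m hmi f hf]
  refine (hC f hf).trans ?_
  gcongr
  rw [← ENNReal.ofReal_coe_nnreal]
  exact ENNReal.ofReal_le_ofReal (by linarith)
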